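/- arXiv:1909.07449 — 2 statements merged into one kernel-verified Lean document; each statement's English description precedes it below -/
import Mathlib

section
/- Let n ≥ 2 and h ≤ σ. There exists a constant C > 0 depending only on the velocity field a, on n, D and T (but not on h, σ, t, or the functions involved) such that for every t ∈ [0,T] and all splines u_σ, v_σ ∈ V_σ^n(Ω): |∫_Ω u_σ(x) v_σ(x) dx − Σ_{i=1}^N w_i u_σ(x_i(t)) v_σ(x_i(t))| ≤ C h |u_σ v_σ|_{W^{1,1}(Ω)}. -/
open MeasureTheory
open scoped ENNReal NNReal

noncomputable section

/-- The open unit cube `Ω = (0,1)^D`. -/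
def unitCube (D : ℕ) : Set (Fin D → ℝ) := {x | ∀ i, x i ∈ Set.Ioo (0 : ℝ) 1}

/-- The grid cell with multi-index `k` in the uniform partition of the unit cube into
`M^D` cubes of edge length `1/M`. -/
def cell (D M : ℕ) (k : Fin D → Fin M) : Set (Fin D → ℝ) :=
  {x | ∀ i, ((k i : ℕ) : ℝ) / M ≤ x i ∧ x i < (((k i : ℕ) : ℝ) + 1) / M}

/-- Membership in the tensor-product spline space `V_σ^n(Ω)`, `σ = 1/M`: the function is
`C^{n-2}` on `Ω` and coincides on every grid cell with a polynomial of coordinate-wise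
degree at most `n-1`. -/
def IsSpline (D M n : ℕ) (u : (Fin D → ℝ) → ℝ) : Prop :=
  ContDiffOn ℝ (n - 2 : ℕ) u (unitCube D) ∧
  ∀ k : Fin D → Fin M, ∃ p : MvPolynomial (Fin D) ℝ,
    (∀ i, p.degreeOf i ≤ n - 1) ∧ ∀ x ∈ cell D M k, u x = MvPolynomial.eval x p

/-- A smooth, bounded, divergence-free velocity field `a` on `Ω × [0,T]`, tangent to the
boundary of the unit cube, together with its flow maps: `X τ t = X_{τ→t}`, so that
`X τ t x` is the position at time `t` of the trajectory passing through `x` at time `τ`. -/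
structure FlowData (D : ℕ) (T : ℝ) where
  a : (Fin D → ℝ) → ℝ → (Fin D → ℝ)
  X : ℝ → ℝ → (Fin D → ℝ) → (Fin D → ℝ)
  smooth : ContDiff ℝ (⊤ : ℕ∞) (Function.uncurry a)
  bounded : ∃ B, ∀ x t, ‖a x t‖ ≤ B
  div_free : ∀ x t, ∑ i, fderiv ℝ (fun y => a y t i) x (Pi.single i 1) = 0
  tangent : ∀ t ∈ Set.Icc (0 : ℝ) T, ∀ x ∈ closure (unitCube D), ∀ i,
      (x i = 0 ∨ x i = 1) → a x t i = 0
  flow_init : ∀ τ x, X τ τ x = x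
  flow_ode : ∀ τ x t, HasDerivAt (fun s => X τ s x) (a (X τ t x) t) t
  flow_inv : ∀ τ t x, X t τ (X τ t x) = x

/-- The `W^{1,1}(Ω)` seminorm `|f|_{W^{1,1}(Ω)} = ∫_Ω ‖∇f‖ dx`. -/
def w11Seminorm (D : ℕ) (f : (Fin D → ℝ) → ℝ) : ℝ :=
  ∫ x in unitCube D, ‖fderiv ℝ f x‖

/-! ### Flow -/

lemma gron {T C : ℝ} {φ φ' : ℝ → ℝ} (hd : ∀ t, HasDerivAt φ (φ' t) t)
    (hb : ∀ t ∈ Set.Icc (0 : ℝ) T, |φ' t| ≤ C * φ t) {τ t : ℝ}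
    (hτ : τ ∈ Set.Icc (0 : ℝ) T) (ht : t ∈ Set.Icc (0 : ℝ) T) :
    φ t ≤ Real.exp (C * |t - τ|) * φ τ := by
  have key : ∀ c : ℝ, ∀ s, HasDerivAt (fun s => φ s * Real.exp (c * s))
      ((φ' s + c * φ s) * Real.exp (c * s)) s := by
    intro c s
    have h1 : HasDerivAt (fun s => Real.exp (c * s)) (Real.exp (c * s) * (c * 1)) s :=
      ((hasDerivAt_id s).const_mul c).exp
    exact ((hd s).fun_mul h1).congr_deriv (by ring)
  rcases le_total τ t with h | h
  · have anti : AntitoneOn (fun s => φ s * Real.exp (-C * s)) (Set.Icc 0 T) := by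
      apply antitoneOn_of_deriv_nonpos (convex_Icc 0 T)
      · exact fun s _ => (key (-C) s).continuousAt.continuousWithinAt
      · exact fun s _ => (key (-C) s).differentiableAt.differentiableWithinAt
      · intro s hs
        rw [(key (-C) s).deriv]
        have := (abs_le.1 (hb s (interior_subset hs))).2
        exact mul_nonpos_of_nonpos_of_nonneg (by linarith) (Real.exp_pos _).le
    have := anti hτ ht h
    simp only at this
    rw [abs_of_nonneg (by linarith)]
    calc φ t = (φ t * Real.exp (-C * t)) * Real.exp (C * t) := by
          rw [mul_assoc, ← Real.exp_add]; simp
      _ ≤ (φ τ * Real.exp (-C * τ)) * Real.exp (C * t) := by gcongr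
      _ = Real.exp (C * (t - τ)) * φ τ := by
          rw [mul_assoc, ← Real.exp_add, mul_comm]; congr 2; ring
  · have mono : MonotoneOn (fun s => φ s * Real.exp (C * s)) (Set.Icc 0 T) := by
      apply monotoneOn_of_deriv_nonneg (convex_Icc 0 T)
      · exact fun s _ => (key C s).continuousAt.continuousWithinAt
      · exact fun s _ => (key C s).differentiableAt.differentiableWithinAt
      · intro s hs
        rw [(key C s).deriv]
        have := (abs_le.1 (hb s (interior_subset hs))).1
        exact mul_nonneg (by linarith) (Real.exp_pos _).le
    have := mono ht hτ h
    simp only at this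
    rw [abs_of_nonpos (by linarith)]
    calc φ t = (φ t * Real.exp (C * t)) * Real.exp (-C * t) := by
          rw [mul_assoc, ← Real.exp_add]; simp
      _ ≤ (φ τ * Real.exp (C * τ)) * Real.exp (-C * t) := by gcongr
      _ = Real.exp (C * -(t - τ)) * φ τ := by
          rw [mul_assoc, ← Real.exp_add, mul_comm]; congr 2; ring

lemma lip_ball {D : ℕ} (T R : ℝ) {g : (Fin D → ℝ) × ℝ → (Fin D → ℝ)}
    (hg : ContDiff ℝ 1 g) :
    ∃ L : ℝ, 0 < L ∧ ∀ t ∈ Set.Icc (0 : ℝ) T, ∀ x ∈ Metric.closedBall (0 : Fin D → ℝ) R,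
      ∀ y ∈ Metric.closedBall (0 : Fin D → ℝ) R, ‖g (x, t) - g (y, t)‖ ≤ L * ‖x - y‖ := by
  have hc : IsCompact (Metric.closedBall (0 : Fin D → ℝ) R ×ˢ Set.Icc (0 : ℝ) T) :=
    (isCompact_closedBall _ _).prod isCompact_Icc
  obtain ⟨L, hL⟩ := hc.exists_bound_of_continuousOn
    (hg.continuous_fderiv (by norm_num)).continuousOn
  refine ⟨max L 1, by positivity, fun t ht x hx y hy => ?_⟩
  have hconv : Convex ℝ (Metric.closedBall (0 : Fin D → ℝ) R ×ˢ Set.Icc (0 : ℝ) T) :=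
    (convex_closedBall _ _).prod (convex_Icc _ _)
  have := hconv.norm_image_sub_le_of_norm_fderiv_le (f := g) (C := max L 1)
    (fun z _ => (hg.differentiable (by norm_num)).differentiableAt)
    (fun z hz => (hL z hz).trans (le_max_left _ _))
    (show (y, t) ∈ _ from ⟨hy, ht⟩) (show (x, t) ∈ _ from ⟨hx, ht⟩)
  refine this.trans_eq ?_
  congr 1
  simp [Prod.norm_def]

lemma closure_unitCube (D : ℕ) : closure (unitCube D) = Set.Icc 0 1 := by
  have : unitCube D = Set.pi Set.univ (fun _ => Set.Ioo (0 : ℝ) 1) := by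
    ext x; simp [unitCube]
  rw [this, closure_pi_set]
  simp only [closure_Ioo (zero_ne_one : (0 : ℝ) ≠ 1)]
  rw [Set.pi_univ_Icc]; rfl

/-- half-open cube -/
def hcube (D : ℕ) : Set (Fin D → ℝ) := {x | ∀ i, 0 ≤ x i ∧ x i < 1}

lemma hcube_sub (D : ℕ) : hcube D ⊆ Set.Icc 0 1 :=
  fun _ hx => ⟨fun i => (hx i).1, fun i => (hx i).2.le⟩

lemma Icc_sub_ball (D : ℕ) : Set.Icc (0 : Fin D → ℝ) 1 ⊆ Metric.closedBall 0 1 := by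
  intro x hx
  rw [mem_closedBall_zero_iff, pi_norm_le_iff_of_nonneg zero_le_one]
  intro i
  rw [Real.norm_eq_abs, abs_le]
  have h1 := hx.1 i
  have h2 := hx.2 i
  simp at h1 h2
  constructor <;> linarith

lemma hasDerivAt_possq (z : ℝ) : HasDerivAt (fun z : ℝ => (max z 0) ^ 2) (2 * max z 0) z := by
  rcases lt_trichotomy z 0 with h | h | h
  · have : (fun z : ℝ => (max z 0) ^ 2) =ᶠ[nhds z] fun _ => 0 := by
      filter_upwards [Iio_mem_nhds h] with w hw
      rw [max_eq_right (le_of_lt hw)]; simp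
    rw [max_eq_right h.le, mul_zero]
    exact (hasDerivAt_const z (0 : ℝ)).congr_of_eventuallyEq this
  · subst h
    simp only [max_self, mul_zero]
    rw [hasDerivAt_iff_isLittleO]
    have : (fun x : ℝ => (max x 0) ^ 2) =o[nhds 0] fun x : ℝ => x := by
      have h2 : (fun x : ℝ => x ^ 2) =o[nhds 0] fun x : ℝ => x := by
        simpa using Asymptotics.isLittleO_pow_pow (𝕜 := ℝ) (m := 1) (n := 2) (by norm_num)
      refine Asymptotics.IsBigO.trans_isLittleO ?_ h2
      apply Asymptotics.IsBigO.of_norm_le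
      intro x
      simp only [norm_pow, Real.norm_eq_abs]
      rcases le_total x 0 with h | h
      · simp [max_eq_right h, sq_nonneg]
      · simp [max_eq_left h]
    simpa using this
  · have : (fun z : ℝ => (max z 0) ^ 2) =ᶠ[nhds z] fun z => z ^ 2 := by
      filter_upwards [Ioi_mem_nhds h] with w hw
      rw [max_eq_left (le_of_lt hw)]
    rw [max_eq_left h.le]
    refine HasDerivAt.congr_of_eventuallyEq ?_ this
    simpa using hasDerivAt_pow 2 z

section flow
variable {D : ℕ} {T : ℝ} (F : FlowData D T)

lemma FlowData.smooth1 : ContDiff ℝ 1 (Function.uncurry F.a) :=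
  F.smooth.of_le (by exact_mod_cast le_top)

lemma FlowData.traj_cont (τ : ℝ) (x : Fin D → ℝ) : Continuous fun s => F.X τ s x :=
  continuous_iff_continuousAt.2 fun t => (F.flow_ode τ x t).continuousAt

lemma FlowData.coord (τ : ℝ) (x : Fin D → ℝ) (t : ℝ) (i : Fin D) :
    HasDerivAt (fun s => F.X τ s x i) (F.a (F.X τ t x) t i) t :=
  (hasDerivAt_pi.1 (F.flow_ode τ x t)) i

lemma FlowData.inv_Icc {τ t : ℝ} (hτ : τ ∈ Set.Icc (0 : ℝ) T) (ht : t ∈ Set.Icc (0 : ℝ) T)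
    {x : Fin D → ℝ} (hx : x ∈ Set.Icc 0 1) : F.X τ t x ∈ Set.Icc 0 1 := by
  obtain ⟨R0, hR0⟩ := (isCompact_Icc (a := (0:ℝ)) (b := T)).exists_bound_of_continuousOn
    (F.traj_cont τ x).continuousOn
  set R := max R0 1
  obtain ⟨L, hL0, hL⟩ := lip_ball T R F.smooth1
  set y : ℝ → Fin D → ℝ := fun s => F.X τ s x with hy
  let e : ℝ → Fin D → ℝ := fun s i => max (-(y s i)) 0 + max (y s i - 1) 0
  let φ : ℝ → ℝ := fun s => ∑ i, ((max (-(y s i)) 0) ^ 2 + (max (y s i - 1) 0) ^ 2)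
  let φ' : ℝ → ℝ := fun s => ∑ i, (2 * max (-(y s i)) 0 * (-(F.a (y s) s i)) +
    2 * max (y s i - 1) 0 * (F.a (y s) s i))
  have hd : ∀ s, HasDerivAt φ (φ' s) s := by
    intro s
    apply HasDerivAt.fun_sum
    intro i _
    have h0 := F.coord τ x s i
    exact ((hasDerivAt_possq _).comp s h0.neg).add
      ((hasDerivAt_possq _).comp s (h0.sub_const 1))
  have hφ0 : ∀ s, 0 ≤ φ s := fun s => Finset.sum_nonneg fun i _ => by positivity
  -- bound
  have hb : ∀ s ∈ Set.Icc (0 : ℝ) T, |φ' s| ≤ (D * (2 * L)) * φ s := by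
    intro s hs
    have hyR : y s ∈ Metric.closedBall (0 : Fin D → ℝ) R := by
      rw [mem_closedBall_zero_iff]; exact (hR0 s hs).trans (le_max_left _ _)
    let c : Fin D → ℝ := fun i => max 0 (min (y s i) 1)
    have hc : c ∈ Set.Icc (0 : Fin D → ℝ) 1 :=
      ⟨fun i => le_max_left _ _, fun i => max_le zero_le_one (min_le_right _ _)⟩
    have hcR : c ∈ Metric.closedBall (0 : Fin D → ℝ) R :=
      Metric.closedBall_subset_closedBall (le_max_right _ _) (Icc_sub_ball D hc)
    have hlip := hL s hs _ hyR _ hcR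
    have hsq : ∀ i, (y s i - c i) ^ 2 = (max (-(y s i)) 0) ^ 2 + (max (y s i - 1) 0) ^ 2 := by
      intro i
      show (y s i - max 0 (min (y s i) 1)) ^ 2 = _
      rcases le_total (y s i) 0 with h | h
      · rw [min_eq_left (by linarith), max_eq_left h, max_eq_left (by linarith),
          max_eq_right (by linarith)]; ring
      · rcases le_total (y s i) 1 with h' | h'
        · rw [min_eq_left h', max_eq_right h, max_eq_right (by linarith),
            max_eq_right (by linarith)]; ring
        · rw [min_eq_right h', max_eq_right zero_le_one, max_eq_right (by linarith),
            max_eq_left (by linarith)]; ring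
    have hnorm : ‖y s - c‖ ≤ Real.sqrt (φ s) := by
      rw [pi_norm_le_iff_of_nonneg (Real.sqrt_nonneg _)]
      intro i
      apply Real.le_sqrt_of_sq_le
      rw [Real.norm_eq_abs, sq_abs, Pi.sub_apply, hsq]
      exact Finset.single_le_sum
        (f := fun i => ((max (-(y s i)) 0) ^ 2 + (max (y s i - 1) 0) ^ 2))
        (fun i _ => by positivity) (Finset.mem_univ i)
    have hterm : ∀ i, |2 * max (-(y s i)) 0 * (-(F.a (y s) s i)) +
        2 * max (y s i - 1) 0 * (F.a (y s) s i)| ≤ 2 * L * φ s := by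
      intro i
      have hai : |F.a (y s) s i - F.a c s i| ≤ L * Real.sqrt (φ s) := by
        have := (norm_le_pi_norm (F.a (y s) s - F.a c s) i).trans hlip
        exact this.trans (by gcongr)
      have hyi : |y s i - c i| ≤ Real.sqrt (φ s) := (norm_le_pi_norm (y s - c) i).trans hnorm
      have hmain : |2 * max (-(y s i)) 0 * (-(F.a (y s) s i)) +
          2 * max (y s i - 1) 0 * (F.a (y s) s i)| ≤
          2 * (|y s i - c i| * |F.a (y s) s i - F.a c s i|) := by
        rw [← abs_mul, ← abs_two, ← abs_mul, abs_two]
        apply le_of_eq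
        congr 1
        rcases lt_or_ge (y s i) 0 with h | h
        · have hci : c i = 0 := by
            show max 0 (min (y s i) 1) = 0
            rw [min_eq_left (by linarith), max_eq_left h.le]
          have := F.tangent s hs c (by rw [closure_unitCube]; exact hc) i (Or.inl hci)
          rw [this, hci, max_eq_left (by linarith), max_eq_right (by linarith)]; ring
        · rcases le_or_gt (y s i) 1 with h' | h'
          · have hci : c i = y s i := by
              show max 0 (min (y s i) 1) = _
              rw [min_eq_left h', max_eq_right h]
            rw [hci, max_eq_right (by linarith), max_eq_right (by linarith)]; ring
          · have hci : c i = 1 := by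
              show max 0 (min (y s i) 1) = _
              rw [min_eq_right h'.le, max_eq_right zero_le_one]
            have := F.tangent s hs c (by rw [closure_unitCube]; exact hc) i (Or.inr hci)
            rw [this, hci, max_eq_right (by linarith), max_eq_left (by linarith)]; ring
      refine hmain.trans ?_
      calc 2 * (|y s i - c i| * |F.a (y s) s i - F.a c s i|)
          ≤ 2 * (Real.sqrt (φ s) * (L * Real.sqrt (φ s))) := by gcongr
        _ = 2 * L * (Real.sqrt (φ s) * Real.sqrt (φ s)) := by ring
        _ = 2 * L * φ s := by rw [Real.mul_self_sqrt (hφ0 s)]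
    calc |φ' s| ≤ ∑ i : Fin D, (2 * L * φ s) :=
          (Finset.abs_sum_le_sum_abs _ _).trans (Finset.sum_le_sum fun i _ => hterm i)
      _ = (D * (2 * L)) * φ s := by simp; ring
  have hend := gron hd hb hτ ht
  have hφτ : φ τ = 0 := by
    apply Finset.sum_eq_zero
    intro i _
    have h1 := hx.1 i
    have h2 := hx.2 i
    simp only [Pi.zero_apply, Pi.one_apply] at h1 h2
    simp only [hy, F.flow_init]
    rw [max_eq_right (by linarith), max_eq_right (by linarith)]; simp
  rw [hφτ, mul_zero] at hend
  have hz := (Finset.sum_eq_zero_iff_of_nonneg (fun i _ => by positivity)).1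
    (le_antisymm hend (hφ0 t))
  constructor
  · intro i
    have := hz i (Finset.mem_univ i)
    have h1 : max (-(y t i)) 0 = 0 := by
      have h3 := sq_nonneg (max (-(y t i)) 0)
      have h4 := sq_nonneg (max (y t i - 1) 0)
      exact pow_eq_zero_iff (two_ne_zero) |>.1 (by linarith)
    have := le_max_left (-(y t i)) 0
    simp only [Pi.zero_apply]
    show 0 ≤ y t i
    linarith
  · intro i
    have := hz i (Finset.mem_univ i)
    have h1 : max (y t i - 1) 0 = 0 := by
      have h3 := sq_nonneg (max (-(y t i)) 0)
      have h4 := sq_nonneg (max (y t i - 1) 0)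
      exact pow_eq_zero_iff (two_ne_zero) |>.1 (by linarith)
    have := le_max_left (y t i - 1) 0
    simp only [Pi.one_apply]
    show y t i ≤ 1
    linarith

lemma FlowData.lip : ∃ L : ℝ, 0 < L ∧ ∀ t ∈ Set.Icc (0 : ℝ) T,
    ∀ x ∈ Set.Icc (0 : Fin D → ℝ) 1, ∀ y ∈ Set.Icc (0 : Fin D → ℝ) 1,
      ‖F.a x t - F.a y t‖ ≤ L * ‖x - y‖ := by
  obtain ⟨L, h0, h⟩ := lip_ball T 1 F.smooth1
  exact ⟨L, h0, fun t ht x hx y hy => h t ht x (Icc_sub_ball D hx) y (Icc_sub_ball D hy)⟩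

lemma FlowData.inv_hcube {τ t : ℝ} (hτ : τ ∈ Set.Icc (0 : ℝ) T) (ht : t ∈ Set.Icc (0 : ℝ) T)
    {x : Fin D → ℝ} (hx : x ∈ hcube D) : F.X τ t x ∈ hcube D := by
  have hI : ∀ s ∈ Set.Icc (0:ℝ) T, F.X τ s x ∈ Set.Icc (0 : Fin D → ℝ) 1 :=
    fun s hs => F.inv_Icc hτ hs (hcube_sub D hx)
  obtain ⟨L, hL0, hL⟩ := F.lip
  intro i
  refine ⟨(hI t ht).1 i, ?_⟩
  have hd : ∀ s, HasDerivAt (fun s => 1 - F.X τ s x i) (- F.a (F.X τ s x) s i) s :=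
    fun s => (F.coord τ x s i).const_sub 1
  have hb : ∀ s ∈ Set.Icc (0:ℝ) T, |-F.a (F.X τ s x) s i| ≤ L * (1 - F.X τ s x i) := by
    intro s hs
    set y := F.X τ s x
    have hy := hI s hs
    have hy1 : y i ≤ 1 := hy.2 i
    let c := Function.update y i 1
    have hc : c ∈ Set.Icc (0 : Fin D → ℝ) 1 := by
      constructor
      · intro j
        by_cases h : j = i
        · subst h; simp [c]
        · simpa [c, h] using hy.1 j
      · intro j
        by_cases h : j = i
        · subst h; simp [c]
        · simpa [c, h] using hy.2 j
    have h0 : F.a c s i = 0 :=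
      F.tangent s hs c (by rw [closure_unitCube]; exact hc) i (Or.inr (by simp [c]))
    have hyc : ‖y - c‖ ≤ 1 - y i := by
      rw [pi_norm_le_iff_of_nonneg (by linarith)]
      intro j
      by_cases h : j = i
      · subst h
        simp only [c, Pi.sub_apply, Function.update_self, Real.norm_eq_abs]
        rw [abs_of_nonpos (by linarith)]; linarith
      · simp [c, h, hy1]
    rw [abs_neg]
    have h1 := (norm_le_pi_norm (F.a y s - F.a c s) i).trans (hL s hs y hy c hc)
    rw [Pi.sub_apply, h0, sub_zero] at h1
    exact h1.trans (by gcongr)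
  have := gron hd hb ht hτ
  simp only [F.flow_init] at this
  by_contra hcon
  push Not at hcon
  have h1 : 1 - F.X τ t x i ≤ 0 := by linarith
  have h2 := mul_nonpos_of_nonneg_of_nonpos (Real.exp_pos (L * |τ - t|)).le h1
  have := (hx i).2
  linarith

/-- general distance estimate between two trajectories in the cube -/
lemma FlowData.two_traj : ∃ Λ : ℝ, 1 ≤ Λ ∧ ∀ y z : ℝ → Fin D → ℝ,
    (∀ s, HasDerivAt y (F.a (y s) s) s) → (∀ s, HasDerivAt z (F.a (z s) s) s) →
    (∀ s ∈ Set.Icc (0:ℝ) T, y s ∈ Set.Icc (0 : Fin D → ℝ) 1) →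
    (∀ s ∈ Set.Icc (0:ℝ) T, z s ∈ Set.Icc (0 : Fin D → ℝ) 1) →
    ∀ τ ∈ Set.Icc (0:ℝ) T, ∀ t ∈ Set.Icc (0:ℝ) T, ‖y t - z t‖ ≤ Λ * ‖y τ - z τ‖ := by
  obtain ⟨L, hL0, hL⟩ := F.lip
  set C : ℝ := D * (2 * L)
  refine ⟨max 1 (Real.sqrt (Real.exp (C * T) * D)), le_max_left _ _, ?_⟩
  intro y z hy hz hyI hzI τ hτ t ht
  let φ : ℝ → ℝ := fun s => ∑ i, (y s i - z s i) ^ 2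
  let φ' : ℝ → ℝ := fun s => ∑ i, 2 * (y s i - z s i) * (F.a (y s) s i - F.a (z s) s i)
  have hd : ∀ s, HasDerivAt φ (φ' s) s := by
    intro s
    apply HasDerivAt.fun_sum
    intro i _
    have h1 := ((hasDerivAt_pi.1 (hy s)) i).sub ((hasDerivAt_pi.1 (hz s)) i)
    exact (h1.fun_pow 2).congr_deriv (by simp)
  have hn : ∀ s, ‖y s - z s‖ ^ 2 ≤ φ s := by
    intro s
    have : ‖y s - z s‖ ≤ Real.sqrt (φ s) := by
      rw [pi_norm_le_iff_of_nonneg (Real.sqrt_nonneg _)]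
      intro i
      apply Real.le_sqrt_of_sq_le
      rw [Real.norm_eq_abs, sq_abs, Pi.sub_apply]
      exact Finset.single_le_sum (f := fun i => (y s i - z s i) ^ 2)
        (fun i _ => by positivity) (Finset.mem_univ i)
    calc _ ≤ Real.sqrt (φ s) ^ 2 := by gcongr
      _ = φ s := Real.sq_sqrt (Finset.sum_nonneg fun i _ => by positivity)
  have hb : ∀ s ∈ Set.Icc (0:ℝ) T, |φ' s| ≤ C * φ s := by
    intro s hs
    calc |φ' s| ≤ ∑ i : Fin D, (2 * L * φ s) := by
          refine (Finset.abs_sum_le_sum_abs _ _).trans (Finset.sum_le_sum fun i _ => ?_)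
          rw [abs_mul, abs_mul, abs_two]
          have h1 : |y s i - z s i| ≤ ‖y s - z s‖ := norm_le_pi_norm (y s - z s) i
          have h2 : |F.a (y s) s i - F.a (z s) s i| ≤ L * ‖y s - z s‖ :=
            (norm_le_pi_norm (F.a (y s) s - F.a (z s) s) i).trans
              (hL s hs _ (hyI s hs) _ (hzI s hs))
          calc 2 * |y s i - z s i| * |F.a (y s) s i - F.a (z s) s i|
              ≤ 2 * ‖y s - z s‖ * (L * ‖y s - z s‖) := by gcongr
            _ = 2 * L * ‖y s - z s‖ ^ 2 := by ring
            _ ≤ _ := by gcongr; exact hn s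
      _ = C * φ s := by simp [C]; ring
  have h := gron hd hb hτ ht
  have hφτ : φ τ ≤ D * ‖y τ - z τ‖ ^ 2 := by
    calc φ τ ≤ ∑ i : Fin D, ‖y τ - z τ‖ ^ 2 := by
          refine Finset.sum_le_sum fun i _ => ?_
          rw [← sq_abs]
          gcongr
          exact norm_le_pi_norm (y τ - z τ) i
      _ = _ := by simp
  have hCT : Real.exp (C * |t - τ|) ≤ Real.exp (C * T) := by
    apply Real.exp_le_exp.2
    have : |t - τ| ≤ T := abs_le.2 ⟨by linarith [ht.1, hτ.2], by linarith [ht.2, hτ.1]⟩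
    have : 0 ≤ C := by positivity
    gcongr
  have hfin : ‖y t - z t‖ ^ 2 ≤ Real.exp (C * T) * D * ‖y τ - z τ‖ ^ 2 := by
    calc _ ≤ φ t := hn t
      _ ≤ _ := h
      _ ≤ Real.exp (C * T) * (D * ‖y τ - z τ‖ ^ 2) := by gcongr
      _ = _ := by ring
  calc ‖y t - z t‖ ≤ Real.sqrt (Real.exp (C * T) * D * ‖y τ - z τ‖ ^ 2) :=
        Real.le_sqrt_of_sq_le hfin
    _ = Real.sqrt (Real.exp (C * T) * D) * ‖y τ - z τ‖ := by
        rw [Real.sqrt_mul (by positivity), Real.sqrt_sq (norm_nonneg _)]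
    _ ≤ _ := by gcongr; exact le_max_right _ _

lemma FlowData.X_lip : ∃ Λ : ℝ, 1 ≤ Λ ∧ ∀ τ ∈ Set.Icc (0:ℝ) T, ∀ t ∈ Set.Icc (0:ℝ) T,
    ∀ x ∈ Set.Icc (0 : Fin D → ℝ) 1, ∀ y ∈ Set.Icc (0 : Fin D → ℝ) 1,
    ‖F.X τ t x - F.X τ t y‖ ≤ Λ * ‖x - y‖ := by
  obtain ⟨Λ, h1, h⟩ := F.two_traj
  refine ⟨Λ, h1, fun τ hτ t ht x hx y hy => ?_⟩
  have := h (fun s => F.X τ s x) (fun s => F.X τ s y) (F.flow_ode τ x) (F.flow_ode τ y)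
    (fun s hs => F.inv_Icc hτ hs hx) (fun s hs => F.inv_Icc hτ hs hy) τ hτ t ht
  simpa only [F.flow_init] using this

lemma FlowData.X_comp {τ s t : ℝ} (hτ : τ ∈ Set.Icc (0:ℝ) T) (hs : s ∈ Set.Icc (0:ℝ) T)
    (ht : t ∈ Set.Icc (0:ℝ) T) {x : Fin D → ℝ} (hx : x ∈ Set.Icc (0 : Fin D → ℝ) 1) :
    F.X s t (F.X τ s x) = F.X τ t x := by
  obtain ⟨Λ, h1, h⟩ := F.two_traj
  have := h (fun r => F.X s r (F.X τ s x)) (fun r => F.X τ r x) (F.flow_ode s _) (F.flow_ode τ x)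
    (fun r hr => F.inv_Icc hs hr (F.inv_Icc hτ hs hx)) (fun r hr => F.inv_Icc hτ hr hx) s hs t ht
  simp only [F.flow_init, sub_self, norm_zero, mul_zero] at this
  exact sub_eq_zero.1 (norm_le_zero_iff.1 this)

/-- second-order expansion of the flow -/
lemma FlowData.expand : ∃ C : ℝ, 0 < C ∧ ∀ s ∈ Set.Icc (0:ℝ) T, ∀ t ∈ Set.Icc (0:ℝ) T,
    ∀ x ∈ Set.Icc (0 : Fin D → ℝ) 1, ∀ y ∈ Set.Icc (0 : Fin D → ℝ) 1,
    ‖(F.X s t x - F.X s t y) - (x - y) - (t - s) • (F.a x s - F.a y s)‖ ≤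
      C * |t - s| ^ 2 * ‖x - y‖ := by
  obtain ⟨Λ, hΛ, hX⟩ := F.X_lip
  let b : (Fin D → ℝ) × ℝ → (Fin D → ℝ) :=
    fun z => fderiv ℝ (Function.uncurry F.a) z (Function.uncurry F.a z, 1)
  have hbs : ContDiff ℝ 1 b := by
    have h1 : ContDiff ℝ 1 (fderiv ℝ (Function.uncurry F.a)) :=
      F.smooth.fderiv_right (by norm_cast)
    exact h1.clm_apply (F.smooth1.prodMk contDiff_const)
  obtain ⟨L, hL0, hL⟩ := lip_ball T 1 hbs
  refine ⟨L * Λ, by positivity, fun s hs t ht x hx y hy => ?_⟩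
  have hder : ∀ x r, HasDerivAt (fun r => F.a (F.X s r x) r) (b (F.X s r x, r)) r := by
    intro x r
    have h1 : HasFDerivAt (Function.uncurry F.a) (fderiv ℝ (Function.uncurry F.a) (F.X s r x, r))
      (F.X s r x, r) := (F.smooth1.differentiable (by norm_num)).differentiableAt.hasFDerivAt
    exact HasFDerivAt.comp_hasDerivAt (f := fun r => (F.X s r x, r)) r h1
      ((F.flow_ode s x r).prodMk (hasDerivAt_id r))
  have hsub : ∀ r ∈ Set.uIcc s t, r ∈ Set.Icc (0:ℝ) T := fun r hr =>
    (Set.uIcc_subset_Icc hs ht) hr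
  have hr1 : ∀ r ∈ Set.uIcc s t, |r - s| ≤ |t - s| := fun r hr => by
    have := Set.abs_sub_left_of_mem_uIcc hr
    exact this
  have step1 : ∀ r ∈ Set.uIcc s t,
      ‖(F.a (F.X s r x) r - F.a (F.X s r y) r) - (F.a x s - F.a y s)‖ ≤
        L * Λ * ‖x - y‖ * |t - s| := by
    intro r hr
    have := (convex_uIcc s t).norm_image_sub_le_of_norm_hasDerivWithin_le
      (f := fun r => F.a (F.X s r x) r - F.a (F.X s r y) r) (C := L * Λ * ‖x - y‖)
      (fun r _ => ((hder x r).sub (hder y r)).hasDerivWithinAt)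
      (fun r hr => by
        have h1 := hL r (hsub r hr) _ (Icc_sub_ball D (F.inv_Icc hs (hsub r hr) hx))
          _ (Icc_sub_ball D (F.inv_Icc hs (hsub r hr) hy))
        have h2 := hX s hs r (hsub r hr) x hx y hy
        calc _ ≤ _ := h1
          _ ≤ L * (Λ * ‖x - y‖) := by gcongr
          _ = _ := by ring) (Set.left_mem_uIcc) hr
    simp only [F.flow_init] at this
    refine this.trans ?_
    gcongr
    exact hr1 r hr
  have step2 := (convex_uIcc s t).norm_image_sub_le_of_norm_hasDerivWithin_le
      (f := fun r => F.X s r x - F.X s r y - (r - s) • (F.a x s - F.a y s))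
      (f' := fun r => F.a (F.X s r x) r - F.a (F.X s r y) r - (F.a x s - F.a y s))
      (C := L * Λ * ‖x - y‖ * |t - s|)
      (fun r _ => by
        have h3 : HasDerivAt (fun r : ℝ => (r - s) • (F.a x s - F.a y s))
            ((1:ℝ) • (F.a x s - F.a y s)) r := ((hasDerivAt_id r).sub_const s).smul_const _
        rw [one_smul] at h3
        exact (((F.flow_ode s x r).sub (F.flow_ode s y r)).sub h3).hasDerivWithinAt)
      step1 (Set.left_mem_uIcc) (Set.right_mem_uIcc)
  simp only [F.flow_init, sub_self, zero_smul, sub_zero, Real.norm_eq_abs] at step2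
  calc _ = ‖F.X s t x - F.X s t y - (t - s) • (F.a x s - F.a y s) - (x - y)‖ := by
        congr 1; abel
    _ ≤ _ := step2
    _ = _ := by ring

end flow

/-! ### Volume preservation -/

/-- trace in coordinates -/
def ctr {D : ℕ} (H : (Fin D → ℝ) →L[ℝ] (Fin D → ℝ)) : ℝ := ∑ i, H (Pi.single i 1) i

lemma ctr_le {D : ℕ} (H : (Fin D → ℝ) →L[ℝ] (Fin D → ℝ)) : |ctr H| ≤ D * ‖H‖ := by
  calc |ctr H| ≤ ∑ i : Fin D, ‖H‖ := by
        refine (Finset.abs_sum_le_sum_abs _ _).trans (Finset.sum_le_sum fun i _ => ?_)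
        have h1 := norm_le_pi_norm (H (Pi.single i 1)) i
        have h2 := H.le_opNorm (Pi.single i 1)
        have h3 : ‖(Pi.single i 1 : Fin D → ℝ)‖ = 1 := by simp [Pi.norm_single]
        rw [h3, mul_one] at h2
        exact h1.trans h2
    _ = _ := by simp

lemma det_expand (D : ℕ) {ε : ℝ} (hε : 0 < ε) : ∃ ρ : ℝ, 0 < ρ ∧
    ∀ H : (Fin D → ℝ) →L[ℝ] (Fin D → ℝ), ‖H‖ ≤ ρ →
      |(ContinuousLinearMap.id ℝ (Fin D → ℝ) + H).det - 1 - ctr H| ≤ ε * ‖H‖ := by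
  let toM : ((Fin D → ℝ) →L[ℝ] (Fin D → ℝ)) → Matrix (Fin D) (Fin D) ℝ :=
    fun H => LinearMap.toMatrix' (H : (Fin D → ℝ) →ₗ[ℝ] (Fin D → ℝ))
  have hM : ∀ H i j, toM H i j = H (Pi.single j 1) i := by
    intro H i j
    simp [toM, LinearMap.toMatrix'_apply]
  have hdet : ∀ H : (Fin D → ℝ) →L[ℝ] (Fin D → ℝ),
      (ContinuousLinearMap.id ℝ (Fin D → ℝ) + H).det = (1 + toM H).det := by
    intro H
    have : (1 + toM H) = LinearMap.toMatrix'
      ((ContinuousLinearMap.id ℝ (Fin D → ℝ) + H : (Fin D → ℝ) →L[ℝ] (Fin D → ℝ)) :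
        (Fin D → ℝ) →ₗ[ℝ] (Fin D → ℝ)) := by
      simp [toM]
    rw [this, LinearMap.det_toMatrix']
  have htr : ∀ H, ctr H = (toM H).trace := by
    intro H
    simp [ctr, Matrix.trace, hM]
  let g : ((Fin D → ℝ) →L[ℝ] (Fin D → ℝ)) → ℝ := fun H => (1 + toM H).det
  have hg : DifferentiableAt ℝ g 0 := by
    have : g = fun H => ∑ σ : Equiv.Perm (Fin D), ((Equiv.Perm.sign σ : ℤ) : ℝ) *
        ∏ i, ((1 : Matrix (Fin D) (Fin D) ℝ) (σ i) i + H (Pi.single i 1) (σ i)) := by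
      funext H
      simp only [g, Matrix.det_apply', Matrix.add_apply, hM]
    rw [this]
    apply DifferentiableAt.fun_sum
    intro σ _
    apply DifferentiableAt.const_mul
    have hcd : ContDiff ℝ 1 (fun y : (Fin D → ℝ) →L[ℝ] (Fin D → ℝ) =>
        ∏ i, ((1 : Matrix (Fin D) (Fin D) ℝ) (σ i) i + y (Pi.single i 1) (σ i))) := by
      apply contDiff_prod
      intro i _
      apply contDiff_const.add
      have h1 : ContDiff ℝ 1 (fun H : (Fin D → ℝ) →L[ℝ] (Fin D → ℝ) => H (Pi.single i 1)) :=
        (ContinuousLinearMap.apply ℝ (Fin D → ℝ) (Pi.single i (1:ℝ) : Fin D → ℝ)).contDiff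
      exact (contDiff_pi.1 h1) (σ i)
    exact (hcd.differentiable (by norm_num)).differentiableAt
  have hL : ∀ H, fderiv ℝ g 0 H = ctr H := by
    intro H
    have h1 : HasDerivAt (fun r : ℝ => g (r • H)) (fderiv ℝ g 0 H) 0 := by
      have h2 : HasDerivAt (fun r : ℝ => r • H) ((1:ℝ) • H) 0 := (hasDerivAt_id 0).smul_const H
      rw [one_smul] at h2
      have h3 : HasFDerivAt g (fderiv ℝ g 0) ((fun r : ℝ => r • H) 0) := by
        simpa using hg.hasFDerivAt
      exact h3.comp_hasDerivAt (f := fun r : ℝ => r • H) 0 h2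
    have h4 : HasDerivAt (fun r : ℝ => g (r • H)) (ctr H) 0 := by
      have : (fun r : ℝ => g (r • H)) = fun r => 1 + (toM H).trace * r +
          (Matrix.det (1 + (Polynomial.X : Polynomial ℝ) •
            (toM H).map Polynomial.C)).divX.divX.eval r * r ^ 2 := by
        funext r
        rw [← Matrix.det_one_add_smul]
        have : toM (r • H) = r • toM H := by
          ext i j
          simp [hM]
        simp only [g, this]
      rw [this, htr]
      set P := (Matrix.det (1 + (Polynomial.X : Polynomial ℝ) •
            (toM H).map Polynomial.C)).divX.divX
      have h5 := (((hasDerivAt_id (0:ℝ)).const_mul (toM H).trace).const_add 1).add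
        ((P.hasDerivAt 0).fun_mul (hasDerivAt_pow 2 (0:ℝ)))
      refine h5.congr_deriv ?_
      simp
    exact h1.unique h4
  have h6 := (hasFDerivAt_iff_isLittleO_nhds_zero.1 hg.hasFDerivAt).def hε
  rw [Metric.eventually_nhds_iff] at h6
  obtain ⟨ρ, hρ, h⟩ := h6
  refine ⟨ρ / 2, by positivity, fun H hH => ?_⟩
  have := h (y := H) (by rw [dist_zero_right]; linarith)
  rw [zero_add, hL, Real.norm_eq_abs] at this
  have h0 : g 0 = 1 := by
    have : toM 0 = 0 := by ext i j; simp [hM]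
    simp [g, this]
  rw [h0] at this
  rw [hdet]
  exact this

lemma isOpen_unitCube (D : ℕ) : IsOpen (unitCube D) := by
  have : unitCube D = Set.pi Set.univ (fun _ => Set.Ioo (0 : ℝ) 1) := by
    ext x; simp [unitCube]
  rw [this]
  exact isOpen_set_pi Set.finite_univ fun _ _ => isOpen_Ioo

lemma unitCube_sub (D : ℕ) : unitCube D ⊆ Set.Icc 0 1 :=
  fun _ hx => ⟨fun i => (hx i).1.le, fun i => (hx i).2.le⟩

lemma unitCube_sub_hcube (D : ℕ) : unitCube D ⊆ hcube D :=
  fun _ hx i => ⟨(hx i).1.le, (hx i).2⟩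

lemma unitCube_ae_Icc (D : ℕ) : unitCube D =ᵐ[volume] (Set.Icc 0 1 : Set (Fin D → ℝ)) := by
  have : unitCube D = Set.pi Set.univ (fun _ => Set.Ioo (0 : ℝ) 1) := by
    ext x; simp [unitCube]
  rw [this]
  exact Measure.univ_pi_Ioo_ae_eq_Icc (μ := fun _ : Fin D => (volume : Measure ℝ))
    (f := (0 : Fin D → ℝ)) (g := 1)

lemma vol_Icc (D : ℕ) : volume (Set.Icc (0 : Fin D → ℝ) 1) = 1 := by
  rw [Real.volume_Icc_pi]; simp

lemma hcube_ae_unitCube (D : ℕ) : hcube D =ᵐ[volume] unitCube D := by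
  refine Filter.EventuallyLE.antisymm ?_ (unitCube_sub_hcube D).eventuallyLE
  exact (hcube_sub D).eventuallyLE.trans (unitCube_ae_Icc D).symm.le

lemma measurableSet_hcube (D : ℕ) : MeasurableSet (hcube D) := by
  have : hcube D = Set.pi Set.univ (fun _ => Set.Ico (0 : ℝ) 1) := by
    ext x; simp [hcube]
  rw [this]
  exact MeasurableSet.univ_pi fun _ => measurableSet_Ico

lemma lip_null {D : ℕ} {K : ℝ≥0} {f : (Fin D → ℝ) → (Fin D → ℝ)} {s : Set (Fin D → ℝ)}
    (hf : LipschitzOnWith K f s) (hs : volume s = 0) : volume (f '' s) = 0 := by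
  have h := hf.hausdorffMeasure_image_le (d := Fintype.card (Fin D)) (by positivity)
  rw [hausdorffMeasure_pi_real, hs, mul_zero] at h
  exact le_antisymm h (zero_le)

section flow2
variable {D : ℕ} {T : ℝ} (F : FlowData D T)

lemma FlowData.X_lipOn : ∃ Λ : ℝ≥0, ∀ τ ∈ Set.Icc (0:ℝ) T, ∀ t ∈ Set.Icc (0:ℝ) T,
    LipschitzOnWith Λ (F.X τ t) (Set.Icc 0 1) := by
  obtain ⟨Λ, h1, h⟩ := F.X_lip
  refine ⟨⟨Λ, by linarith⟩, fun τ hτ t ht => LipschitzOnWith.of_dist_le_mul fun x hx y hy => ?_⟩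
  rw [dist_eq_norm, dist_eq_norm]
  exact h τ hτ t ht x hx y hy

lemma FlowData.X_inj (τ t : ℝ) : Function.Injective (F.X τ t) :=
  Function.LeftInverse.injective (g := F.X t τ) (F.flow_inv τ t)

lemma FlowData.det_bound {ε : ℝ} (hε : 0 < ε) : ∃ δ : ℝ, 0 < δ ∧
    ∀ s ∈ Set.Icc (0:ℝ) T, ∀ t ∈ Set.Icc (0:ℝ) T, |t - s| ≤ δ →
    ∀ x ∈ unitCube D, DifferentiableAt ℝ (F.X s t) x →
      |(fderiv ℝ (F.X s t) x).det - 1| ≤ ε * |t - s| := by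
  obtain ⟨L, hL0, hL⟩ := F.lip
  obtain ⟨C, hC0, hC⟩ := F.expand
  obtain ⟨ρ, hρ, hdet⟩ := det_expand D (ε := ε / (2 * (L + C))) (by positivity)
  refine ⟨min 1 (min (ρ / (L + C)) (ε / (2 * (D + 1) * C))), by positivity, ?_⟩
  intro s hs t ht hst x hx hdiff
  set δ := |t - s| with hδ
  have hδ0 : 0 ≤ δ := abs_nonneg _
  have hδ1 : δ ≤ 1 := hst.trans (min_le_left _ _)
  have hδ2 : δ ≤ ρ / (L + C) := hst.trans ((min_le_right _ _).trans (min_le_left _ _))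
  have hδ3 : δ ≤ ε / (2 * (D + 1) * C) := hst.trans ((min_le_right _ _).trans (min_le_right _ _))
  have hnear : ∀ᶠ y in nhds x, y ∈ Set.Icc (0 : Fin D → ℝ) 1 := by
    filter_upwards [(isOpen_unitCube D).mem_nhds hx] with y hy using unitCube_sub D hy
  have hxI := unitCube_sub D hx
  have ha : HasFDerivAt (fun y => F.a y s) (fderiv ℝ (fun y => F.a y s) x) x := by
    have : Differentiable ℝ (fun y => F.a y s) := by
      have h1 : Differentiable ℝ (Function.uncurry F.a) := F.smooth1.differentiable (by norm_num)
      exact h1.comp (differentiable_id.prodMk (differentiable_const s))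
    exact this.differentiableAt.hasFDerivAt
  set A := fderiv ℝ (fun y => F.a y s) x
  have hA : ‖A‖ ≤ L := ha.le_of_lip' hL0.le (by
    filter_upwards [hnear] with y hy using hL s hs y hy x hxI)
  set P := fderiv ℝ (F.X s t) x
  have hG : HasFDerivAt (fun y => F.X s t y - y - (t - s) • F.a y s)
      (P - ContinuousLinearMap.id ℝ _ - (t - s) • A) x :=
    (hdiff.hasFDerivAt.sub (hasFDerivAt_id x)).sub (ha.const_smul (t - s))
  set G := P - ContinuousLinearMap.id ℝ _ - (t - s) • A
  have hGn : ‖G‖ ≤ C * δ ^ 2 := hG.le_of_lip' (by positivity) (by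
    filter_upwards [hnear] with y hy
    have := hC s hs t ht y hy x hxI
    refine le_trans (le_of_eq ?_) this
    congr 1
    rw [smul_sub]
    abel)
  set H := P - ContinuousLinearMap.id ℝ (Fin D → ℝ) with hH
  have hHG : H = G + (t - s) • A := by simp [G, hH]
  have hHn : ‖H‖ ≤ (L + C) * δ := by
    calc ‖H‖ ≤ ‖G‖ + ‖(t - s) • A‖ := by rw [hHG]; exact norm_add_le _ _
      _ ≤ C * δ ^ 2 + δ * L := by
          rw [norm_smul, Real.norm_eq_abs]; gcongr
      _ ≤ C * δ + δ * L := by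
          have : δ ^ 2 ≤ δ := by nlinarith
          gcongr
      _ = _ := by ring
  have hAtr : ctr A = 0 := by
    have h := F.div_free x s
    rw [← h]
    refine Finset.sum_congr rfl fun i _ => ?_
    have := (hasFDerivAt_pi'.1 ha) i
    rw [this.fderiv]
    rfl
  have htr : ctr H = ctr G := by
    rw [hHG]
    have : ctr (G + (t - s) • A) = ctr G + (t - s) * ctr A := by
      simp [ctr, Finset.sum_add_distrib, Finset.mul_sum]
    rw [this, hAtr]; ring
  have hP : P = ContinuousLinearMap.id ℝ _ + H := by simp [hH]
  have hρH : ‖H‖ ≤ ρ := by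
    refine hHn.trans ?_
    calc (L + C) * δ ≤ (L + C) * (ρ / (L + C)) := by gcongr
      _ = ρ := by field_simp
  have h1 := hdet H hρH
  rw [← hP, htr] at h1
  have h2 := ctr_le G
  have h3 : ε / (2 * (L + C)) * ‖H‖ ≤ ε / 2 * δ := by
    calc _ ≤ ε / (2 * (L + C)) * ((L + C) * δ) := by gcongr
      _ = _ := by field_simp
  have h4 : D * ‖G‖ ≤ ε / 2 * δ := by
    calc D * ‖G‖ ≤ (D + 1) * (C * δ ^ 2) := by gcongr; linarith
      _ = ((D + 1) * C * δ) * δ := by ring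
      _ ≤ ((D + 1) * C * (ε / (2 * (D + 1) * C))) * δ := by gcongr
      _ = _ := by field_simp
  calc |P.det - 1| = |(P.det - 1 - ctr G) + ctr G| := by congr 1; ring
    _ ≤ |P.det - 1 - ctr G| + |ctr G| := abs_add_le _ _
    _ ≤ ε * δ := by linarith

lemma FlowData.vol_step {ε : ℝ} (hε : 0 < ε) : ∃ δ : ℝ, 0 < δ ∧
    ∀ s ∈ Set.Icc (0:ℝ) T, ∀ t ∈ Set.Icc (0:ℝ) T, |t - s| ≤ δ →
    ∀ A ⊆ Set.Icc (0 : Fin D → ℝ) 1, MeasurableSet A →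
      |volume.real (F.X s t '' A) - volume.real A| ≤ ε * |t - s| := by
  obtain ⟨δ, hδ, hdet⟩ := F.det_bound hε
  obtain ⟨Λ, hΛ⟩ := F.X_lipOn
  refine ⟨min δ (1 / ε), by positivity, fun s hs t ht hst A hA hAm => ?_⟩
  set φ := F.X s t
  have hst1 := hst.trans (min_le_left _ _)
  have hη1 : ε * |t - s| ≤ 1 := by
    calc ε * |t - s| ≤ ε * (1 / ε) := by gcongr; exact hst.trans (min_le_right _ _)
      _ = 1 := by field_simp
  set η := ε * |t - s|
  have hη0 : 0 ≤ η := by positivity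
  set good : Set (Fin D → ℝ) := unitCube D ∩ {x | DifferentiableAt ℝ φ x}
  have hgm : MeasurableSet good :=
    (isOpen_unitCube D).measurableSet.inter (measurableSet_of_differentiableAt ℝ φ)
  have hlip := hΛ s hs t ht
  have hN : volume (A \ good) = 0 := by
    have h1 : ∀ᵐ x ∂(volume : Measure (Fin D → ℝ)), x ∈ Set.Icc (0 : Fin D → ℝ) 1 →
        DifferentiableWithinAt ℝ φ (Set.Icc 0 1) x := hlip.ae_differentiableWithinAt_of_mem
    have h2 := (unitCube_ae_Icc D).mem_iff
    have : ∀ᵐ x ∂(volume : Measure (Fin D → ℝ)), x ∉ A \ good := by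
      filter_upwards [h1, h2] with x hx1 hx2 hx3
      apply hx3.2
      have hxI := hA hx3.1
      have hxu := hx2.2 hxI
      refine ⟨hxu, (hx1 hxI).differentiableAt ?_⟩
      exact Filter.mem_of_superset ((isOpen_unitCube D).mem_nhds hxu) (unitCube_sub D)
    exact measure_eq_zero_iff_ae_notMem.2 this
  have hNi : volume (φ '' (A \ good)) = 0 :=
    lip_null (hlip.mono (Set.sdiff_subset.trans hA)) hN
  set A' := A ∩ good
  have hA'm : MeasurableSet A' := hAm.inter hgm
  have hvA : volume A = volume A' := by
    refine le_antisymm ?_ (measure_mono Set.inter_subset_left)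
    calc volume A = volume (A' ∪ A \ good) := by rw [Set.inter_union_sdiff]
      _ ≤ volume A' + volume (A \ good) := measure_union_le _ _
      _ = volume A' := by rw [hN, add_zero]
  have hvI : volume (φ '' A) = volume (φ '' A') := by
    refine le_antisymm ?_ (measure_mono (Set.image_mono Set.inter_subset_left))
    calc volume (φ '' A) = volume (φ '' A' ∪ φ '' (A \ good)) := by
          rw [← Set.image_union, Set.inter_union_sdiff]
      _ ≤ volume (φ '' A') + volume (φ '' (A \ good)) := measure_union_le _ _
      _ = volume (φ '' A') := by rw [hNi, add_zero]
  have hcv := lintegral_abs_det_fderiv_eq_addHaar_image volume hA'm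
    (f := φ) (f' := fderiv ℝ φ)
    (fun x hx => (show DifferentiableAt ℝ φ x from hx.2.2).hasFDerivAt.hasFDerivWithinAt)
    (F.X_inj s t).injOn
  have hfin : volume A' ≤ 1 := by
    rw [← vol_Icc D]; exact measure_mono (Set.inter_subset_left.trans hA)
  have hfin' : volume A' ≠ ⊤ := ne_top_of_le_ne_top ENNReal.one_ne_top hfin
  have hb : ∀ x ∈ A', |(|(fderiv ℝ φ x).det|) - 1| ≤ η := by
    intro x hx
    have h := hdet s hs t ht hst1 x hx.2.1 hx.2.2
    have h2 := abs_abs_sub_abs_le (fderiv ℝ φ x).det 1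
    rw [abs_one] at h2
    exact h2.trans h
  have hup : volume (φ '' A') ≤ ENNReal.ofReal (1 + η) * volume A' := by
    rw [← hcv, ← setLIntegral_const]
    refine setLIntegral_mono' hA'm fun x hx => ENNReal.ofReal_le_ofReal ?_
    linarith [(abs_le.1 (hb x hx)).2]
  have hlo : ENNReal.ofReal (1 - η) * volume A' ≤ volume (φ '' A') := by
    rw [← hcv, ← setLIntegral_const]
    refine setLIntegral_mono' hA'm fun x hx => ENNReal.ofReal_le_ofReal ?_
    linarith [(abs_le.1 (hb x hx)).1]
  have hfinI : volume (φ '' A') ≠ ⊤ :=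
    ne_top_of_le_ne_top (ENNReal.mul_ne_top ENNReal.ofReal_ne_top hfin') hup
  have hup' := ENNReal.toReal_mono (ENNReal.mul_ne_top ENNReal.ofReal_ne_top hfin') hup
  have hlo' := ENNReal.toReal_mono hfinI hlo
  rw [ENNReal.toReal_mul, ENNReal.toReal_ofReal (by linarith)] at hup' hlo'
  have h1 : (volume A').toReal ≤ 1 := by
    have := ENNReal.toReal_mono ENNReal.one_ne_top hfin
    simpa using this
  have h0 : 0 ≤ (volume A').toReal := ENNReal.toReal_nonneg
  simp only [Measure.real, hvA, hvI]
  rw [abs_le]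
  constructor <;> nlinarith

lemma FlowData.vol_image {τ t : ℝ} (hτ : τ ∈ Set.Icc (0:ℝ) T) (ht : t ∈ Set.Icc (0:ℝ) T)
    {A : Set (Fin D → ℝ)} (hA : A ⊆ Set.Icc (0 : Fin D → ℝ) 1) (hAm : MeasurableSet A) :
    volume (F.X τ t '' A) = volume A := by
  obtain ⟨Λ, hΛ⟩ := F.X_lipOn
  have hsub : ∀ s ∈ Set.Icc (0:ℝ) T, F.X τ s '' A ⊆ Set.Icc (0 : Fin D → ℝ) 1 := by
    rintro s hs _ ⟨x, hx, rfl⟩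
    exact F.inv_Icc hτ hs (hA hx)
  have hm : ∀ s ∈ Set.Icc (0:ℝ) T, MeasurableSet (F.X τ s '' A) := fun s hs =>
    hAm.image_of_continuousOn_injOn ((hΛ τ hτ s hs).continuousOn.mono hA) (F.X_inj τ s).injOn
  let m : ℝ → ℝ := fun s => volume.real (F.X τ s '' A)
  have hd : ∀ s ∈ Set.Icc (0:ℝ) T, HasDerivWithinAt m 0 (Set.Icc 0 T) s := by
    intro s hs
    rw [hasDerivWithinAt_iff_isLittleO, Asymptotics.isLittleO_iff]
    intro ε hε
    obtain ⟨δ, hδ, h⟩ := F.vol_step hε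
    have hev : ∀ᶠ r in nhdsWithin s (Set.Icc 0 T), |r - s| ≤ δ :=
      nhdsWithin_le_nhds (by
        filter_upwards [Metric.closedBall_mem_nhds s hδ] with r hr
        exact hr)
    filter_upwards [hev, self_mem_nhdsWithin] with r hr hrI
    have := h s hs r hrI hr _ (hsub s hs) (hm s hs)
    have himg : F.X s r '' (F.X τ s '' A) = F.X τ r '' A := by
      rw [Set.image_image]
      exact Set.image_congr fun x hx => F.X_comp hτ hs hrI (hA hx)
    rw [himg] at this
    simpa using this
  have hconst := (convex_Icc (0:ℝ) T).norm_image_sub_le_of_norm_hasDerivWithin_le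
    (f := m) (f' := fun _ => 0) (C := 0) hd (by simp) hτ ht
  have heq : m t = m τ := by
    rw [zero_mul] at hconst
    exact sub_eq_zero.1 (norm_le_zero_iff.1 hconst)
  have h0 : F.X τ τ '' A = A := by
    have : F.X τ τ = id := by funext x; exact F.flow_init τ x
    rw [this, Set.image_id]
  have hfin : ∀ B ⊆ Set.Icc (0 : Fin D → ℝ) 1, volume B ≠ ⊤ := fun B hB =>
    ne_top_of_le_ne_top (by rw [vol_Icc]; exact ENNReal.one_ne_top) (measure_mono hB)
  simp only [m, h0] at heq
  exact (ENNReal.toReal_eq_toReal_iff' (hfin _ (hsub t ht)) (hfin _ hA)).1 heq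

lemma FlowData.mp {t : ℝ} (hT : 0 ≤ T) (ht : t ∈ Set.Icc (0:ℝ) T) :
    Measure.map (F.X 0 t) (volume.restrict (hcube D)) = volume.restrict (hcube D) ∧
      AEMeasurable (F.X 0 t) (volume.restrict (hcube D)) := by
  have h0 : (0:ℝ) ∈ Set.Icc (0:ℝ) T := ⟨le_rfl, hT⟩
  obtain ⟨Λ, hΛ⟩ := F.X_lipOn
  have hae : AEMeasurable (F.X 0 t) (volume.restrict (hcube D)) :=
    ((hΛ 0 h0 t ht).continuousOn.mono (hcube_sub D)).aemeasurable (measurableSet_hcube D)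
  refine ⟨?_, hae⟩
  ext A hA
  rw [Measure.map_apply_of_aemeasurable hae hA, Measure.restrict_apply hA,
    Measure.restrict_apply' (measurableSet_hcube D)]
  have : F.X 0 t ⁻¹' A ∩ hcube D = F.X t 0 '' (A ∩ hcube D) := by
    ext x
    constructor
    · rintro ⟨h1, h2⟩
      exact ⟨F.X 0 t x, ⟨h1, F.inv_hcube h0 ht h2⟩, F.flow_inv 0 t x⟩
    · rintro ⟨y, ⟨h1, h2⟩, rfl⟩
      refine ⟨?_, F.inv_hcube ht h0 h2⟩
      rw [Set.mem_preimage, F.flow_inv t 0 y]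
      exact h1
  rw [this]
  exact F.vol_image ht h0 (Set.inter_subset_right.trans (hcube_sub D))
    (hA.inter (measurableSet_hcube D))

end flow2

/-! ### Inverse estimate for polynomials -/

lemma Icc_closure_interior (D : ℕ) :
    Set.Icc (0 : Fin D → ℝ) 1 ⊆ closure (unitCube D) := (closure_unitCube D).ge

/-- in a finite dimensional space of continuous functions on the unit cube, the sup norm is
controlled by the `L¹` norm -/
lemma sup_le_L1 {D : ℕ} {G : Type*} [NormedAddCommGroup G] [NormedSpace ℝ G]
    (W : Submodule ℝ C(Set.Icc (0 : Fin D → ℝ) 1, G)) [FiniteDimensional ℝ W] :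
    ∃ C : ℝ, 0 < C ∧ ∀ w ∈ W, ‖w‖ ≤
      C * ∫ x, ‖w x‖ ∂(Measure.comap Subtype.val (volume : Measure (Fin D → ℝ))) := by
  set μ : Measure (Set.Icc (0 : Fin D → ℝ) 1) :=
    Measure.comap Subtype.val (volume : Measure (Fin D → ℝ)) with hμ
  have hmI : MeasurableSet (Set.Icc (0 : Fin D → ℝ) 1) := measurableSet_Icc
  have hemb : MeasurableEmbedding (Subtype.val : Set.Icc (0 : Fin D → ℝ) 1 → (Fin D → ℝ)) :=
    MeasurableEmbedding.subtype_coe hmI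
  have huniv : μ Set.univ = 1 := by
    rw [hμ, hemb.comap_apply, Set.image_univ, Subtype.range_coe, vol_Icc]
  have : IsProbabilityMeasure μ := ⟨huniv⟩
  have : μ.IsOpenPosMeasure := by
    constructor
    rintro U ⟨V, hV, rfl⟩ ⟨x, hx⟩
    rw [hμ, hemb.comap_apply, Subtype.image_preimage_coe]
    obtain ⟨y, hyV, hyu⟩ := mem_closure_iff.1 (Icc_closure_interior D x.2) V hV hx
    have hpos : 0 < volume (V ∩ unitCube D) :=
      (hV.inter (isOpen_unitCube D)).measure_pos _ ⟨y, hyV, hyu⟩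
    refine (hpos.trans_le (measure_mono ?_)).ne'
    rintro z ⟨h1, h2⟩
    exact ⟨unitCube_sub D h2, h1⟩
  let N1 : C(Set.Icc (0 : Fin D → ℝ) 1, G) → ℝ := fun f => ∫ x, ‖f x‖ ∂μ
  have hint : ∀ f : C(Set.Icc (0 : Fin D → ℝ) 1, G), Integrable (fun x => ‖f x‖) μ := by
    intro f
    exact (BoundedContinuousFunction.mkOfCompact
      (⟨fun x => ‖f x‖, f.continuous.norm⟩ : C(Set.Icc (0 : Fin D → ℝ) 1, ℝ))).integrable μ
  have hN1c : Continuous N1 := by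
    have : LipschitzWith 1 N1 := by
      apply LipschitzWith.of_le_add_mul
      intro f g
      have : ∀ x, ‖f x‖ ≤ ‖g x‖ + dist f g := by
        intro x
        have h1 := ContinuousMap.dist_apply_le_dist (f := f) (g := g) x
        rw [dist_eq_norm] at h1
        have h2 := norm_le_norm_add_norm_sub' (f x) (g x)
        linarith
      calc N1 f ≤ ∫ x, (‖g x‖ + dist f g) ∂μ :=
            integral_mono (hint f) ((hint g).add (integrable_const _)) this
        _ = N1 g + dist f g := by
            rw [integral_add (hint g) (integrable_const _)]; simp [N1]
        _ = _ := by simp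
    exact this.continuous
  have hpos : ∀ f, f ≠ 0 → 0 < N1 f := by
    intro f hf
    refine lt_of_le_of_ne (integral_nonneg fun x => norm_nonneg _) ?_
    intro h0
    apply hf
    have h1 := (integral_eq_zero_iff_of_nonneg (fun x => norm_nonneg _) (hint f)).1 h0.symm
    have h2 := (Continuous.ae_eq_iff_eq μ f.continuous.norm
      (continuous_zero (X := Set.Icc (0 : Fin D → ℝ) 1) (M := ℝ))).1 h1
    ext x
    have := congrFun h2 x
    simpa using this
  have : ProperSpace W := FiniteDimensional.proper ℝ W
  rcases (Metric.sphere (0 : W) 1).eq_empty_or_nonempty with he | hne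
  · refine ⟨1, one_pos, fun w hw => ?_⟩
    have hw0 : w = 0 := by
      by_contra hw0
      have : (⟨(‖w‖⁻¹) • w, W.smul_mem _ hw⟩ : W) ∈ Metric.sphere (0 : W) 1 := by
        rw [mem_sphere_zero_iff_norm]
        show ‖(‖w‖⁻¹) • w‖ = 1
        rw [norm_smul, norm_inv, norm_norm, inv_mul_cancel₀ (norm_ne_zero_iff.2 hw0)]
      rw [he] at this
      exact this
    subst hw0
    simp
  · obtain ⟨w0, hw0, hmin⟩ := (isCompact_sphere (0 : W) 1).exists_isMinOn hne
      ((hN1c.comp continuous_subtype_val).continuousOn)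
    have hw0n : (w0 : C(Set.Icc (0 : Fin D → ℝ) 1, G)) ≠ 0 := by
      intro h
      have : w0 = 0 := Subtype.ext h
      rw [mem_sphere_zero_iff_norm, this, norm_zero] at hw0
      exact zero_ne_one hw0
    set m := N1 w0
    have hm : 0 < m := hpos _ hw0n
    refine ⟨m⁻¹, inv_pos.2 hm, fun w hw => ?_⟩
    by_cases hw1 : w = 0
    · subst hw1; simp
    have hwn : 0 < ‖w‖ := norm_pos_iff.2 hw1
    have hmem : (⟨(‖w‖⁻¹) • w, W.smul_mem _ hw⟩ : W) ∈ Metric.sphere (0 : W) 1 := by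
      rw [mem_sphere_zero_iff_norm]
      show ‖(‖w‖⁻¹) • w‖ = 1
      rw [norm_smul, norm_inv, norm_norm, inv_mul_cancel₀ (norm_ne_zero_iff.2 hw1)]
    have h1 : m ≤ N1 ((‖w‖⁻¹) • w) := hmin hmem
    have h2 : N1 ((‖w‖⁻¹) • w) = ‖w‖⁻¹ * N1 w := by
      simp only [N1, ContinuousMap.smul_apply, norm_smul, norm_inv, norm_norm]
      rw [integral_const_mul]
    rw [h2] at h1
    show ‖w‖ ≤ m⁻¹ * N1 w
    rw [inv_mul_eq_div, le_div_iff₀ hm]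
    calc ‖w‖ * m ≤ ‖w‖ * (‖w‖⁻¹ * N1 w) := by gcongr
      _ = N1 w := by field_simp

lemma mvp_contDiff {D : ℕ} (p : MvPolynomial (Fin D) ℝ) :
    ContDiff ℝ 2 (fun x : Fin D → ℝ => MvPolynomial.eval x p) := by
  induction p using MvPolynomial.induction_on with
  | C a => simpa using contDiff_const
  | add p q hp hq => simpa using hp.add hq
  | mul_X p i hp => simpa using hp.mul (contDiff_apply ℝ ℝ i)

lemma mvp_diff {D : ℕ} (p : MvPolynomial (Fin D) ℝ) :
    Differentiable ℝ (fun x : Fin D → ℝ => MvPolynomial.eval x p) :=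
  (mvp_contDiff p).differentiable (by norm_num)

lemma mvp_fderiv_cont {D : ℕ} (p : MvPolynomial (Fin D) ℝ) :
    Continuous (fderiv ℝ (fun x : Fin D → ℝ => MvPolynomial.eval x p)) :=
  (mvp_contDiff p).continuous_fderiv (by norm_num)

/-- the gradient as a linear map into continuous functions on the cube -/
def gradMap (D : ℕ) : MvPolynomial (Fin D) ℝ →ₗ[ℝ]
    C(Set.Icc (0 : Fin D → ℝ) 1, (Fin D → ℝ) →L[ℝ] ℝ) where
  toFun p := ⟨fun x => fderiv ℝ (fun x : Fin D → ℝ => MvPolynomial.eval x p) x,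
    (mvp_fderiv_cont p).comp continuous_subtype_val⟩
  map_add' p q := by
    ext1 x
    simp only [map_add, ContinuousMap.coe_mk, ContinuousMap.add_apply]
    exact fderiv_add (mvp_diff p).differentiableAt (mvp_diff q).differentiableAt
  map_smul' c p := by
    ext1 x
    simp only [MvPolynomial.smul_eval, ContinuousMap.coe_mk, ContinuousMap.smul_apply,
      RingHom.id_apply]
    exact fderiv_const_mul (mvp_diff p).differentiableAt c

lemma grad_unit (D N : ℕ) : ∃ C : ℝ, 0 < C ∧ ∀ p : MvPolynomial (Fin D) ℝ,
    (∀ i, p.degreeOf i ≤ N) → ∀ z ∈ Set.Icc (0 : Fin D → ℝ) 1,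
    ‖fderiv ℝ (fun x : Fin D → ℝ => MvPolynomial.eval x p) z‖ ≤
      C * ∫ y in Set.Icc (0 : Fin D → ℝ) 1,
        ‖fderiv ℝ (fun x : Fin D → ℝ => MvPolynomial.eval x p) y‖ := by
  let S : Set (Fin D →₀ ℕ) := {m | ∀ i, m i ≤ N}
  have hS : S.Finite := by
    refine (Set.finite_Icc 0 (Finsupp.equivFunOnFinite.symm fun _ : Fin D => N)).subset ?_
    intro m hm
    exact ⟨fun i => Nat.zero_le _, fun i => hm i⟩
  let V : Submodule ℝ (MvPolynomial (Fin D) ℝ) :=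
    Submodule.span ℝ ((fun m => MvPolynomial.monomial m (1:ℝ)) '' S)
  have : FiniteDimensional ℝ V := FiniteDimensional.span_of_finite ℝ (hS.image _)
  obtain ⟨C, hC, h⟩ := sup_le_L1 (V.map (gradMap D))
  refine ⟨C, hC, fun p hp z hz => ?_⟩
  have hpV : p ∈ V := by
    rw [p.as_sum]
    refine Submodule.sum_mem _ fun m hm => ?_
    have : MvPolynomial.monomial m (p.coeff m) = p.coeff m • MvPolynomial.monomial m (1:ℝ) := by
      rw [MvPolynomial.smul_monomial, smul_eq_mul, mul_one]
    rw [this]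
    refine Submodule.smul_mem _ _ (Submodule.subset_span ⟨m, fun i => ?_, rfl⟩)
    exact (MvPolynomial.degreeOf_le_iff.1 (hp i)) m hm
  have h1 := h _ (Submodule.mem_map_of_mem hpV)
  have h2 := ((gradMap D) p).norm_coe_le_norm ⟨z, hz⟩
  have h3 := h2.trans h1
  have h4 : ∫ x, ‖gradMap D p x‖ ∂(Measure.comap Subtype.val (volume : Measure (Fin D → ℝ))) =
      ∫ y in Set.Icc (0 : Fin D → ℝ) 1,
        ‖fderiv ℝ (fun x : Fin D → ℝ => MvPolynomial.eval x p) y‖ :=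
    integral_subtype_comap measurableSet_Icc
      (fun y => ‖fderiv ℝ (fun x : Fin D → ℝ => MvPolynomial.eval x p) y‖)
  rw [h4] at h3
  exact h3

lemma degreeOf_affine {D N : ℕ} (c : Fin D → ℝ) (r : ℝ) (p : MvPolynomial (Fin D) ℝ)
    (hp : ∀ i, p.degreeOf i ≤ N) (i : Fin D) :
    (MvPolynomial.bind₁ (fun j => MvPolynomial.C r * MvPolynomial.X j +
      MvPolynomial.C (c j)) p).degreeOf i ≤ N := by
  classical
  set q : Fin D → MvPolynomial (Fin D) ℝ := fun j => MvPolynomial.C r * MvPolynomial.X j +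
      MvPolynomial.C (c j) with hq
  have hqd : ∀ j, (q j).degreeOf i ≤ if i = j then 1 else 0 := by
    intro j
    refine (MvPolynomial.degreeOf_add_le _ _ _).trans (max_le ?_ ?_)
    · refine (MvPolynomial.degreeOf_mul_le _ _ _).trans ?_
      rw [MvPolynomial.degreeOf_C, MvPolynomial.degreeOf_X, zero_add]
    · rw [MvPolynomial.degreeOf_C]; exact Nat.zero_le _
  conv_lhs => rw [p.as_sum]
  rw [map_sum]
  refine (MvPolynomial.degreeOf_sum_le _ _ _).trans (Finset.sup_le fun m hm => ?_)
  rw [MvPolynomial.bind₁_monomial]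
  refine (MvPolynomial.degreeOf_mul_le _ _ _).trans ?_
  rw [MvPolynomial.degreeOf_C, zero_add]
  refine (MvPolynomial.degreeOf_prod_le _ _ _).trans ?_
  calc ∑ j ∈ m.support, (q j ^ m j).degreeOf i
      ≤ ∑ j ∈ m.support, m j * (if i = j then 1 else 0) := by
        refine Finset.sum_le_sum fun j _ => ?_
        exact (MvPolynomial.degreeOf_pow_le _ _ _).trans (Nat.mul_le_mul le_rfl (hqd j))
    _ ≤ m i := by
        simp only [mul_ite, mul_one, mul_zero, Finset.sum_ite_eq]
        split_ifs <;> simp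
    _ ≤ N := (MvPolynomial.degreeOf_le_iff.1 (hp i)) m hm

open scoped Pointwise in
lemma grad_cell (D N : ℕ) : ∃ C : ℝ, 0 < C ∧ ∀ L : ℕ, 0 < L → ∀ c : Fin D → ℝ,
    ∀ p : MvPolynomial (Fin D) ℝ,
    (∀ i, p.degreeOf i ≤ N) → ∀ x ∈ Set.Icc c (fun i => c i + 1 / L),
    (1 / (L:ℝ)) ^ D * ‖fderiv ℝ (fun x : Fin D → ℝ => MvPolynomial.eval x p) x‖ ≤
      C * ∫ y in Set.Icc c (fun i => c i + 1 / L),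
        ‖fderiv ℝ (fun x : Fin D → ℝ => MvPolynomial.eval x p) y‖ := by
  obtain ⟨C, hC, h⟩ := grad_unit D N
  refine ⟨C, hC, fun L hL c p hp x hx => ?_⟩
  have hL' : (0:ℝ) < L := by exact_mod_cast hL
  set r : ℝ := 1 / L with hr
  have hr0 : 0 < r := by positivity
  set q := MvPolynomial.bind₁ (fun j => MvPolynomial.C r * MvPolynomial.X j +
      MvPolynomial.C (c j)) p with hq
  set g := fderiv ℝ (fun x : Fin D → ℝ => MvPolynomial.eval x p)
  have hqe : ∀ z : Fin D → ℝ, MvPolynomial.eval z q = MvPolynomial.eval (r • z + c) p := by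
    intro z
    rw [hq, ← MvPolynomial.coe_aeval_eq_eval, MvPolynomial.coe_aeval_eq_eval]
    simp only [MvPolynomial.eval, MvPolynomial.eval₂Hom_bind₁]
    congr 2
    funext j
    simp
  have hqf : ∀ z : Fin D → ℝ, fderiv ℝ (fun x : Fin D → ℝ => MvPolynomial.eval x q) z =
      r • g (r • z + c) := by
    intro z
    have h1 : HasFDerivAt (fun z : Fin D → ℝ => r • z + c)
        (r • ContinuousLinearMap.id ℝ (Fin D → ℝ)) z :=
      ((hasFDerivAt_id z).const_smul r).add_const c
    have h2 := (mvp_diff p).differentiableAt.hasFDerivAt (x := r • z + c)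
    have h3 := HasFDerivAt.comp (f := fun z : Fin D → ℝ => r • z + c) z h2 h1
    have h4 : (fun x : Fin D → ℝ => MvPolynomial.eval x q) =
      (fun x : Fin D → ℝ => MvPolynomial.eval x p) ∘ (fun z : Fin D → ℝ => r • z + c) := by
      funext z; exact hqe z
    rw [h4, h3.fderiv]
    ext v
    simp [g]
  -- point
  let z : Fin D → ℝ := fun i => L * (x i - c i)
  have hz : z ∈ Set.Icc (0 : Fin D → ℝ) 1 := by
    constructor
    · intro i
      have := hx.1 i
      simp only [z, Pi.zero_apply]
      exact mul_nonneg hL'.le (by linarith)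
    · intro i
      have := hx.2 i
      simp only [z, Pi.one_apply]
      simp only at this
      calc L * (x i - c i) ≤ L * r := by gcongr; linarith
        _ = 1 := by rw [hr]; field_simp
  have hzx : r • z + c = x := by
    funext i
    simp only [z, Pi.add_apply, Pi.smul_apply, smul_eq_mul, hr]
    field_simp
    ring
  have h1 := h q (degreeOf_affine c r p hp) z hz
  simp only [hqf, hzx, norm_smul, Real.norm_eq_abs, abs_of_pos hr0] at h1
  rw [integral_const_mul] at h1
  have h2 : ‖g x‖ ≤ C * ∫ y in Set.Icc (0 : Fin D → ℝ) 1, ‖g (r • y + c)‖ := by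
    have : r * ‖g x‖ ≤ r * (C * ∫ y in Set.Icc (0 : Fin D → ℝ) 1, ‖g (r • y + c)‖) := by
      linarith
    exact le_of_mul_le_mul_left this hr0
  have h3 : ∫ y in Set.Icc (0 : Fin D → ℝ) 1, ‖g (r • y + c)‖ =
      (r ^ D)⁻¹ * ∫ y in Set.Icc c (fun i => c i + r), ‖g y‖ := by
    have h4 := Measure.setIntegral_comp_smul (volume : Measure (Fin D → ℝ))
      (fun y => ‖g (y + c)‖) (Set.Icc (0 : Fin D → ℝ) 1) (R := r) hr0.ne'
    rw [h4]
    have h5 := (measurePreserving_add_right (volume : Measure (Fin D → ℝ)) c).setIntegral_preimage_emb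
      (measurableEmbedding_addRight c) (fun y => ‖g y‖) (Set.Icc c (fun i => c i + r))
    have h6 : (r • Set.Icc (0 : Fin D → ℝ) 1) =
        (fun y => y + c) ⁻¹' (Set.Icc c (fun i => c i + r)) := by
      ext y
      rw [Set.mem_smul_set_iff_inv_smul_mem₀ hr0.ne']
      simp only [Set.mem_preimage, Set.mem_Icc, Pi.le_def, Pi.zero_apply, Pi.smul_apply,
        smul_eq_mul, Pi.one_apply, Pi.add_apply]
      constructor
      · rintro ⟨h7, h8⟩
        constructor
        · intro i
          have := h7 i
          rw [inv_mul_eq_div, le_div_iff₀ hr0] at this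
          linarith
        · intro i
          have := h8 i
          rw [inv_mul_eq_div, div_le_iff₀ hr0] at this
          linarith
      · rintro ⟨h7, h8⟩
        constructor
        · intro i
          have := h7 i
          rw [inv_mul_eq_div, le_div_iff₀ hr0]
          linarith
        · intro i
          have := h8 i
          rw [inv_mul_eq_div, div_le_iff₀ hr0]
          linarith
    rw [h6, h5]
    simp only [Module.finrank_fintype_fun_eq_card, Fintype.card_fin, smul_eq_mul]
    rw [abs_of_pos (by positivity)]
  rw [h3] at h2
  calc r ^ D * ‖g x‖ ≤ r ^ D * (C * ((r ^ D)⁻¹ * ∫ y in Set.Icc c (fun i => c i + r), ‖g y‖)) := by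
        gcongr
    _ = _ := by field_simp

/-! ### Grid combinatorics -/

/-- cell centre -/
def cmid (D L : ℕ) (j : Fin D → Fin L) : Fin D → ℝ := fun i => (((j i : ℕ) : ℝ) + 1 / 2) / L

/-- closed cell -/
def ccell (D L : ℕ) (j : Fin D → Fin L) : Set (Fin D → ℝ) :=
  Set.Icc (fun i => ((j i : ℕ) : ℝ) / L) (fun i => ((j i : ℕ) : ℝ) / L + 1 / L)

lemma cell_sub_ccell {D L : ℕ} (j : Fin D → Fin L) : cell D L j ⊆ ccell D L j := by
  intro x hx
  refine ⟨fun i => (hx i).1, fun i => ?_⟩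
  have := (hx i).2.le
  rw [add_div] at this
  exact this

lemma cell_eq_pi {D L : ℕ} (j : Fin D → Fin L) : cell D L j =
    Set.pi Set.univ (fun i => Set.Ico (((j i : ℕ) : ℝ) / L) ((((j i : ℕ) : ℝ) + 1) / L)) := by
  ext x; simp [cell]

lemma measurableSet_cell {D L : ℕ} (j : Fin D → Fin L) : MeasurableSet (cell D L j) := by
  rw [cell_eq_pi]
  exact MeasurableSet.univ_pi fun _ => measurableSet_Ico

lemma convex_cell {D L : ℕ} (j : Fin D → Fin L) : Convex ℝ (cell D L j) := by
  rw [cell_eq_pi]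
  exact convex_pi fun _ _ => convex_Ico _ _

lemma vol_cell {D L : ℕ} (j : Fin D → Fin L) : volume.real (cell D L j) = (1 / (L:ℝ)) ^ D := by
  rw [cell_eq_pi, Measure.real, Real.volume_pi_Ico]
  have : ∀ i, (((j i : ℕ) : ℝ) + 1) / L - ((j i : ℕ) : ℝ) / L = 1 / L := fun i => by ring
  simp [this]

lemma vol_cell_ne_top {D L : ℕ} (j : Fin D → Fin L) : volume (cell D L j) ≠ ⊤ := by
  rw [cell_eq_pi, Real.volume_pi_Ico]
  exact ENNReal.prod_ne_top fun _ _ => ENNReal.ofReal_ne_top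

lemma cell_ae_ccell {D L : ℕ} (j : Fin D → Fin L) :
    cell D L j =ᵐ[volume] ccell D L j := by
  have h := Measure.univ_pi_Ico_ae_eq_Icc (μ := fun _ : Fin D => (volume : Measure ℝ))
    (f := fun i => ((j i : ℕ) : ℝ) / L) (g := fun i => (((j i : ℕ) : ℝ) + 1) / L)
  rw [cell_eq_pi, ccell]
  simp only [← add_div]
  exact h

/-- open cell -/
def ocell (D L : ℕ) (j : Fin D → Fin L) : Set (Fin D → ℝ) :=
  Set.pi Set.univ (fun i => Set.Ioo (((j i : ℕ) : ℝ) / L) ((((j i : ℕ) : ℝ) + 1) / L))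

lemma ocell_ae_ccell {D L : ℕ} (j : Fin D → Fin L) :
    ocell D L j =ᵐ[volume] ccell D L j := by
  have h := Measure.univ_pi_Ioo_ae_eq_Icc (μ := fun _ : Fin D => (volume : Measure ℝ))
    (f := fun i => ((j i : ℕ) : ℝ) / L) (g := fun i => (((j i : ℕ) : ℝ) + 1) / L)
  rw [ocell, ccell]
  simp only [← add_div]
  exact h

lemma isOpen_ocell {D L : ℕ} (j : Fin D → Fin L) : IsOpen (ocell D L j) :=
  isOpen_set_pi Set.finite_univ fun _ _ => isOpen_Ioo

lemma ocell_sub {D L : ℕ} (j : Fin D → Fin L) : ocell D L j ⊆ cell D L j := by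
  rw [cell_eq_pi]
  exact Set.pi_mono fun _ _ => Set.Ioo_subset_Ico_self

lemma cell_sub_hcube {D L : ℕ} (hL : 0 < L) (j : Fin D → Fin L) : cell D L j ⊆ hcube D := by
  intro x hx i
  have hL' : (0:ℝ) < L := by exact_mod_cast hL
  refine ⟨le_trans (by positivity) (hx i).1, lt_of_lt_of_le (hx i).2 ?_⟩
  rw [div_le_one hL']
  exact_mod_cast (j i).2

lemma exists_cell {D L : ℕ} (hL : 0 < L) {x : Fin D → ℝ} (hx : x ∈ hcube D) :
    ∃ j, x ∈ cell D L j := by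
  have hL' : (0:ℝ) < L := by exact_mod_cast hL
  have h0 : ∀ i, 0 ≤ x i * L := fun i => mul_nonneg (hx i).1 hL'.le
  have hlt : ∀ i, ⌊x i * L⌋₊ < L := fun i => by
    rw [Nat.floor_lt (h0 i)]
    nlinarith [(hx i).2]
  refine ⟨fun i => ⟨⌊x i * L⌋₊, hlt i⟩, fun i => ⟨?_, ?_⟩⟩
  · rw [div_le_iff₀ hL']
    exact Nat.floor_le (h0 i)
  · rw [lt_div_iff₀ hL']
    exact Nat.lt_floor_add_one _

lemma hcube_eq_iUnion {D L : ℕ} (hL : 0 < L) : hcube D = ⋃ j, cell D L j := by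
  ext x
  simp only [Set.mem_iUnion]
  exact ⟨fun hx => exists_cell hL hx, fun ⟨j, hj⟩ => cell_sub_hcube hL j hj⟩

/-- index comparison -/
lemma cell_idx {D L : ℕ} (hL : 0 < L) {j c : Fin D → Fin L} {x y : Fin D → ℝ}
    (hx : x ∈ cell D L j) (hy : y ∈ cell D L c) {ρ : ℝ} (h : ‖x - y‖ * L ≤ ρ) (i : Fin D) :
    |((j i : ℕ) : ℝ) - ((c i : ℕ) : ℝ)| ≤ ρ + 1 := by
  have hL' : (0:ℝ) < L := by exact_mod_cast hL
  have hi : |x i - y i| * L ≤ ρ := by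
    refine le_trans ?_ h
    gcongr
    exact norm_le_pi_norm (x - y) i
  have h1 := (hx i).1
  have h2 := (hx i).2
  have h3 := (hy i).1
  have h4 := (hy i).2
  rw [div_le_iff₀ hL'] at h1 h3
  rw [lt_div_iff₀ hL'] at h2 h4
  have h5 := abs_le.1 (le_refl |x i - y i|)
  have h6 : (x i - y i) * L ≤ |x i - y i| * L := by gcongr; exact h5.2
  have h7 : -(x i - y i) * L ≤ |x i - y i| * L := by gcongr; linarith [h5.1]
  rw [abs_le]
  constructor <;> nlinarith

lemma cell_disjoint {D L : ℕ} (hL : 0 < L) :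
    Pairwise (Function.onFun Disjoint (cell D L)) := by
  intro j c hjc
  rw [Function.onFun, Set.disjoint_left]
  intro x hx hy
  apply hjc
  have hL' : (0:ℝ) < L := by exact_mod_cast hL
  funext i
  have h1 := (hx i).1
  have h2 := (hx i).2
  have h3 := (hy i).1
  have h4 := (hy i).2
  rw [div_le_iff₀ hL'] at h1 h3
  rw [lt_div_iff₀ hL'] at h2 h4
  have h5 : ((j i : ℕ) : ℝ) < ((c i : ℕ) : ℝ) + 1 := by linarith
  have h6 : ((c i : ℕ) : ℝ) < ((j i : ℕ) : ℝ) + 1 := by linarith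
  have h5' : (j i : ℕ) < (c i : ℕ) + 1 := by exact_mod_cast h5
  have h6' : (c i : ℕ) < (j i : ℕ) + 1 := by exact_mod_cast h6
  exact Fin.ext (by omega)

lemma cell_dist {D L : ℕ} (hL : 0 < L) {j : Fin D → Fin L} {x y : Fin D → ℝ}
    (hx : x ∈ ccell D L j) (hy : y ∈ ccell D L j) : ‖x - y‖ ≤ 1 / L := by
  have hL' : (0:ℝ) < L := by exact_mod_cast hL
  rw [pi_norm_le_iff_of_nonneg (by positivity)]
  intro i
  have h1 := hx.1 i
  have h2 := hx.2 i
  have h3 := hy.1 i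
  have h4 := hy.2 i
  simp only at h1 h2 h3 h4
  rw [Pi.sub_apply, Real.norm_eq_abs, abs_le]
  constructor <;> linarith

lemma cmid_mem {D L : ℕ} (hL : 0 < L) (j : Fin D → Fin L) : cmid D L j ∈ cell D L j := by
  have hL' : (0:ℝ) < L := by exact_mod_cast hL
  intro i
  simp only [cmid]
  constructor
  · gcongr; linarith
  · gcongr; linarith

/-- A continuous, piecewise polynomial function on the `L`-grid with local gradient bounds `G`. -/
structure PP (D L : ℕ) (f : (Fin D → ℝ) → ℝ) (P : (Fin D → Fin L) → MvPolynomial (Fin D) ℝ)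
    (G : (Fin D → Fin L) → ℝ) : Prop where
  cont : ContinuousOn f (unitCube D)
  eq : ∀ j, ∀ x ∈ cell D L j, f x = MvPolynomial.eval x (P j)
  bd : ∀ j, ∀ x ∈ ccell D L j,
    ‖fderiv ℝ (fun x : Fin D → ℝ => MvPolynomial.eval x (P j)) x‖ ≤ G j

section pp
variable {D L : ℕ} {f : (Fin D → ℝ) → ℝ} {P : (Fin D → Fin L) → MvPolynomial (Fin D) ℝ}
    {G : (Fin D → Fin L) → ℝ}

lemma PP.nonneg (h : PP D L f P G) (hL : 0 < L) (j : Fin D → Fin L) : 0 ≤ G j :=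
  (norm_nonneg _).trans (h.bd j _ (cell_sub_ccell j (cmid_mem hL j)))

lemma PP.poly_lip (h : PP D L f P G) (hL : 0 < L) (j : Fin D → Fin L) {x y : Fin D → ℝ}
    (hx : x ∈ ccell D L j) (hy : y ∈ ccell D L j) :
    |MvPolynomial.eval x (P j) - MvPolynomial.eval y (P j)| ≤ G j * (1 / L) := by
  have h1 := (convex_Icc (𝕜 := ℝ) (fun i => ((j i : ℕ) : ℝ) / L)
    (fun i => ((j i : ℕ) : ℝ) / L + 1 / L)).norm_image_sub_le_of_norm_fderiv_le
    (f := fun x : Fin D → ℝ => MvPolynomial.eval x (P j)) (C := G j)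
    (fun x _ => (mvp_diff (P j)).differentiableAt) (fun x hx => h.bd j x hx) hy hx
  refine h1.trans ?_
  have := h.nonneg hL j
  gcongr
  exact cell_dist hL hx hy

lemma PP.in_cell (h : PP D L f P G) (hL : 0 < L) (j : Fin D → Fin L) {x y : Fin D → ℝ}
    (hx : x ∈ cell D L j) (hy : y ∈ cell D L j) : |f x - f y| ≤ G j * (1 / L) := by
  rw [h.eq j x hx, h.eq j y hy]
  exact h.poly_lip hL j (cell_sub_ccell j hx) (cell_sub_ccell j hy)

lemma PP.adj (h : PP D L f P G) (hL : 0 < L) {j k : Fin D → Fin L} {i : Fin D}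
    (hi : (k i : ℕ) = (j i : ℕ) + 1) (hne : ∀ l, l ≠ i → k l = j l) :
    |f (cmid D L j) - f (cmid D L k)| ≤ (G j + G k) * (1 / L) := by
  have hL' : (0:ℝ) < L := by exact_mod_cast hL
  set m := cmid D L j
  let w : Fin D → ℝ := Function.update m i ((((j i : ℕ) : ℝ) + 1) / L)
  have hmj := cmid_mem hL j
  have hwk : w ∈ cell D L k := by
    intro l
    by_cases hl : l = i
    · subst hl
      simp only [w, Function.update_self, hi]
      push_cast
      exact ⟨le_rfl, by gcongr; linarith⟩
    · simp only [w, Function.update_of_ne hl, hne l hl]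
      exact hmj l
  have hwj : w ∈ ccell D L j := by
    constructor
    · intro l
      by_cases hl : l = i
      · subst hl
        simp only [w, Function.update_self]
        gcongr; linarith
      · simp only [w, Function.update_of_ne hl]
        exact (hmj l).1
    · intro l
      by_cases hl : l = i
      · subst hl
        simp only [w, Function.update_self]
        rw [add_div]
      · simp only [w, Function.update_of_ne hl]
        exact (cell_sub_ccell j hmj).2 l
  have hwu : w ∈ unitCube D := by
    intro l
    refine ⟨?_, (cell_sub_hcube hL k hwk l).2⟩
    by_cases hl : l = i
    · subst hl
      simp only [w, Function.update_self]
      positivity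
    · simp only [w, Function.update_of_ne hl, m, cmid]
      positivity
  -- f w = P_j w
  have hfw : f w = MvPolynomial.eval w (P j) := by
    let γ : ℝ → Fin D → ℝ := fun θ => m + θ • (w - m)
    have hγ1 : γ 1 = w := by simp [γ]
    have hγc : Continuous γ := by fun_prop
    have hγcell : ∀ θ ∈ Set.Ico (0:ℝ) 1, γ θ ∈ cell D L j := by
      intro θ hθ l
      by_cases hl : l = i
      · subst hl
        have h1 : γ θ l = (((j l : ℕ) : ℝ) + 1 / 2 + θ / 2) / L := by
          simp only [γ, w, m, cmid, Pi.add_apply, Pi.smul_apply, Pi.sub_apply,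
            Function.update_self, smul_eq_mul]
          ring
        rw [h1]
        constructor
        · exact div_le_div_of_nonneg_right (by linarith [hθ.1]) hL'.le
        · exact div_lt_div_of_pos_right (by linarith [hθ.2]) hL'
      · have h1 : γ θ l = m l := by
          simp [γ, w, Function.update_of_ne hl]
        rw [h1]
        exact hmj l
    have hfc : ContinuousAt f (γ 1) := by
      rw [hγ1]
      exact h.cont.continuousAt ((isOpen_unitCube D).mem_nhds hwu)
    have ht1 : Filter.Tendsto (fun θ => f (γ θ)) (nhdsWithin 1 (Set.Iio 1)) (nhds (f w)) := by
      have := (ContinuousAt.comp (f := γ) (x := (1:ℝ)) hfc hγc.continuousAt).tendsto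
      rw [Function.comp_apply, hγ1] at this
      exact this.mono_left nhdsWithin_le_nhds
    have ht2 : Filter.Tendsto (fun θ => MvPolynomial.eval (γ θ) (P j))
        (nhdsWithin 1 (Set.Iio 1)) (nhds (MvPolynomial.eval w (P j))) := by
      have := (((mvp_contDiff (P j)).continuous.comp hγc).tendsto 1)
      rw [Function.comp_apply, hγ1] at this
      exact this.mono_left nhdsWithin_le_nhds
    refine tendsto_nhds_unique ht1 (ht2.congr' ?_)
    have : Set.Ico (0:ℝ) 1 ∈ nhdsWithin (1:ℝ) (Set.Iio 1) := Ico_mem_nhdsLT (by norm_num)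
    filter_upwards [this] with θ hθ
    exact (h.eq j _ (hγcell θ hθ)).symm
  have h1 : |f m - f w| ≤ G j * (1 / L) := by
    rw [hfw, h.eq j m hmj]
    exact h.poly_lip hL j (cell_sub_ccell j hmj) hwj
  have h2 : |f w - f (cmid D L k)| ≤ G k * (1 / L) := h.in_cell hL k hwk (cmid_mem hL k)
  have h3 := abs_sub_le (f m) (f w) (f (cmid D L k))
  linarith

/-- indices within `R` of `c` -/
def nearI (R : ℕ) (c j : Fin D → Fin L) : Prop := ∀ i, ((j i : ℕ) : ℤ) - (c i : ℕ) ≤ R ∧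
  ((c i : ℕ) : ℤ) - (j i : ℕ) ≤ R

lemma nearI_symm {R : ℕ} {c j : Fin D → Fin L} (h : nearI R c j) : nearI R j c :=
  fun i => ⟨(h i).2, (h i).1⟩

open Classical in
/-- sum of the gradient bounds near `c` -/
def nearS (G : (Fin D → Fin L) → ℝ) (R : ℕ) (c : Fin D → Fin L) : ℝ :=
  ∑ j ∈ Finset.univ.filter (fun j => nearI R c j), G j

lemma le_nearS (hG : ∀ j, 0 ≤ G j) {R : ℕ} {c j : Fin D → Fin L} (h : nearI R c j) :
    G j ≤ nearS G R c := by
  classical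
  exact Finset.single_le_sum (f := G) (fun j _ => hG j) (by simpa using h)

/-- grid distance -/
def gd (j k : Fin D → Fin L) : ℕ := ∑ i, (((j i : ℕ) : ℤ) - (k i : ℕ)).natAbs

lemma gd_symm (j k : Fin D → Fin L) : gd j k = gd k j := by
  unfold gd
  refine Finset.sum_congr rfl fun i _ => ?_
  omega

lemma PP.path (h : PP D L f P G) (hL : 0 < L) (R : ℕ) (c : Fin D → Fin L) : ∀ n : ℕ,
    ∀ j k : Fin D → Fin L, nearI R c j → nearI R c k → gd j k = n →
      |f (cmid D L j) - f (cmid D L k)| ≤ n * (2 * nearS G R c * (1 / L)) := by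
  have hL' : (0:ℝ) < L := by exact_mod_cast hL
  intro n
  induction n with
  | zero =>
    intro j k _ _ hd
    have : j = k := by
      funext i
      have := (Finset.sum_eq_zero_iff.1 hd) i (Finset.mem_univ i)
      exact Fin.ext (by omega)
    subst this
    simp
  | succ n ih =>
    -- one-sided step
    have step : ∀ j k : Fin D → Fin L, nearI R c j → nearI R c k → gd j k = n + 1 →
        (∃ i, (j i : ℕ) < (k i : ℕ)) →
        |f (cmid D L j) - f (cmid D L k)| ≤ ((n + 1 : ℕ) : ℝ) * (2 * nearS G R c * (1 / L)) := by
      rintro j k hj hk hd ⟨i, hi⟩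
      let j' : Fin D → Fin L := Function.update j i ⟨(j i : ℕ) + 1, by omega⟩
      have hj'i : (j' i : ℕ) = (j i : ℕ) + 1 := by simp [j']
      have hj'n : ∀ l, l ≠ i → j' l = j l := fun l hl => by simp [j', hl]
      have hj'near : nearI R c j' := by
        intro l
        by_cases hl : l = i
        · subst hl
          have h1 := hj l
          have h2 := hk l
          rw [hj'i]
          omega
        · rw [hj'n l hl]; exact hj l
      have hgd : gd j' k = n := by
        have h1 : gd j k = gd j' k + 1 := by
          unfold gd
          rw [← Finset.add_sum_erase _ _ (Finset.mem_univ i),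
            ← Finset.add_sum_erase (a := i) _ (fun l => (((j' l : ℕ) : ℤ) - (k l : ℕ)).natAbs)
              (Finset.mem_univ i)]
          have h2 : ∑ l ∈ Finset.univ.erase i, (((j' l : ℕ) : ℤ) - (k l : ℕ)).natAbs =
              ∑ l ∈ Finset.univ.erase i, (((j l : ℕ) : ℤ) - (k l : ℕ)).natAbs := by
            refine Finset.sum_congr rfl fun l hl => ?_
            rw [hj'n l (Finset.ne_of_mem_erase hl)]
          rw [h2, hj'i]
          omega
        omega
      have h1 := ih j' k hj'near hk hgd
      have h2 := h.adj hL hj'i hj'n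
      have h3 := abs_sub_le (f (cmid D L j)) (f (cmid D L j')) (f (cmid D L k))
      have h4 := le_nearS (h.nonneg hL) hj
      have h5 := le_nearS (h.nonneg hL) hj'near
      have h6 : (G j + G j') * (1 / L) ≤ 2 * nearS G R c * (1 / L) := by
        gcongr; linarith
      push_cast
      linarith
    intro j k hj hk hd
    by_cases hex : ∃ i, (j i : ℕ) < (k i : ℕ)
    · exact step j k hj hk hd hex
    · have : ∃ i, (k i : ℕ) < (j i : ℕ) := by
        by_contra hno
        push Not at hex hno
        have : gd j k = 0 := Finset.sum_eq_zero fun i _ => by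
          have := hex i
          have := hno i
          omega
        omega
      rw [abs_sub_comm]
      exact step k j hk hj (by rw [gd_symm]; exact hd) this

lemma PP.osc (h : PP D L f P G) (hL : 0 < L) (R : ℕ) {c j : Fin D → Fin L} (hj : nearI R c j)
    {x y : Fin D → ℝ} (hx : x ∈ cell D L c) (hy : y ∈ cell D L j) :
    |f y - f x| ≤ (2 * D * R + 2) * nearS G R c * (1 / L) := by
  have hL' : (0:ℝ) < L := by exact_mod_cast hL
  have hc : nearI R c c := fun i => by omega
  have h1 := h.path hL R c _ j c hj hc rfl
  have h2 := h.in_cell hL j hy (cmid_mem hL j)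
  have h3 := h.in_cell hL c (cmid_mem hL c) hx
  have h4 := le_nearS (h.nonneg hL) hj
  have h5 := le_nearS (h.nonneg hL) hc
  have hS : 0 ≤ nearS G R c := (h.nonneg hL c).trans h5
  have hgd : (gd j c : ℝ) ≤ D * R := by
    have : gd j c ≤ D * R := by
      calc gd j c ≤ ∑ i : Fin D, R := Finset.sum_le_sum fun i _ => by
            have := hj i
            omega
        _ = _ := by simp
    exact_mod_cast this
  have h6 : (gd j c : ℝ) * (2 * nearS G R c * (1 / L)) ≤ (D * R) * (2 * nearS G R c * (1 / L)) := by
    gcongr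
  have h7 : G j * (1 / L) ≤ nearS G R c * (1 / L) := by gcongr
  have h8 : G c * (1 / L) ≤ nearS G R c * (1 / L) := by gcongr
  have h9 := abs_sub_le (f y) (f (cmid D L j)) (f x)
  have h10 := abs_sub_le (f (cmid D L j)) (f (cmid D L c)) (f x)
  calc |f y - f x| ≤ nearS G R c * (1 / L) + ((D * R) * (2 * nearS G R c * (1 / L)) +
        nearS G R c * (1 / L)) := by linarith
    _ = _ := by ring

end pp

lemma card_near {D K : ℕ} (R : ℕ) (s : Finset (Fin D → Fin K))
    (hs : ∀ k ∈ s, ∀ l ∈ s, nearI R k l) : s.card ≤ (2 * R + 1) ^ D := by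
  classical
  rcases s.eq_empty_or_nonempty with rfl | ⟨k, hk⟩
  · simp
  · have hsub : s ⊆ Fintype.piFinset (fun i : Fin D => (Finset.univ : Finset (Fin K)).filter
        (fun a : Fin K => (k i : ℕ) ≤ a.val + R ∧ a.val ≤ (k i : ℕ) + R)) := by
      intro l hl
      rw [Fintype.mem_piFinset]
      intro i
      have := hs k hk l hl i
      simp only [Finset.mem_filter, Finset.mem_univ, true_and]
      omega
    refine (Finset.card_le_card hsub).trans ?_
    rw [Fintype.card_piFinset]
    calc _ ≤ ∏ i : Fin D, (2 * R + 1) := by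
          refine Finset.prod_le_prod' fun i _ => ?_
          have himg : (((Finset.univ : Finset (Fin K)).filter
            (fun a : Fin K => (k i : ℕ) ≤ a.val + R ∧ a.val ≤ (k i : ℕ) + R)).image
              Fin.val) ⊆ Finset.Icc ((k i : ℕ) - R) ((k i : ℕ) + R) := by
            intro a ha
            simp only [Finset.mem_image, Finset.mem_filter, Finset.mem_univ, true_and] at ha
            obtain ⟨b, hb, rfl⟩ := ha
            rw [Finset.mem_Icc]
            omega
          have h1 := Finset.card_le_card himg
          rw [Finset.card_image_of_injective _ Fin.val_injective, Nat.card_Icc] at h1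
          omega
      _ = _ := by simp

/-! ### Final assembly -/

section fin
variable {D L : ℕ} {f : (Fin D → ℝ) → ℝ} {P : (Fin D → Fin L) → MvPolynomial (Fin D) ℝ}

lemma pw_integrable (hL : 0 < L)
    (heq : ∀ j, ∀ x ∈ cell D L j, f x = MvPolynomial.eval x (P j)) :
    IntegrableOn f (hcube D) := by
  rw [hcube_eq_iUnion hL, integrableOn_finite_iUnion]
  intro j
  have h1 : IntegrableOn (fun x => MvPolynomial.eval x (P j)) (ccell D L j) :=
    (mvp_contDiff (P j)).continuous.continuousOn.integrableOn_compact isCompact_Icc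
  exact (h1.mono_set (cell_sub_ccell j)).congr_fun (fun x hx => (heq j x hx).symm)
    (measurableSet_cell j)

lemma pw_seminorm (hL : 0 < L)
    (heq : ∀ j, ∀ x ∈ cell D L j, f x = MvPolynomial.eval x (P j)) :
    w11Seminorm D f = ∑ j, ∫ y in ccell D L j,
      ‖fderiv ℝ (fun x : Fin D → ℝ => MvPolynomial.eval x (P j)) y‖ := by
  have hder : ∀ j, ∀ x ∈ ocell D L j,
      ‖fderiv ℝ (fun x : Fin D → ℝ => MvPolynomial.eval x (P j)) x‖ = ‖fderiv ℝ f x‖ := by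
    intro j x hx
    have : f =ᶠ[nhds x] (fun x : Fin D → ℝ => MvPolynomial.eval x (P j)) := by
      filter_upwards [(isOpen_ocell j).mem_nhds hx] with y hy
      exact heq j y (ocell_sub j hy)
    rw [this.fderiv_eq]
  have hint : ∀ j, IntegrableOn (fun x => ‖fderiv ℝ f x‖) (cell D L j) := by
    intro j
    have h1 : IntegrableOn (fun x =>
        ‖fderiv ℝ (fun x : Fin D → ℝ => MvPolynomial.eval x (P j)) x‖) (ccell D L j) :=
      (mvp_fderiv_cont (P j)).norm.continuousOn.integrableOn_compact isCompact_Icc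
    have h2 := (h1.congr_set_ae (ocell_ae_ccell j)).congr_fun (hder j) (isOpen_ocell j).measurableSet
    exact h2.congr_set_ae ((cell_ae_ccell j).trans (ocell_ae_ccell j).symm)
  unfold w11Seminorm
  rw [← setIntegral_congr_set (hcube_ae_unitCube D), hcube_eq_iUnion hL,
    integral_iUnion_fintype (fun j => measurableSet_cell j) (cell_disjoint hL) hint]
  refine Finset.sum_congr rfl fun j _ => ?_
  rw [setIntegral_congr_set ((cell_ae_ccell j).trans (ocell_ae_ccell j).symm),
    ← setIntegral_congr_set (ocell_ae_ccell j)]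
  exact (setIntegral_congr_fun (isOpen_ocell j).measurableSet (hder j)).symm

/-- coarse index -/
def coarse {D : ℕ} (M m : ℕ) (j : Fin D → Fin (M * m)) : Fin D → Fin M :=
  fun i => ⟨(j i : ℕ) / m, Nat.div_lt_of_lt_mul (lt_of_lt_of_eq (j i).2 (mul_comm M m))⟩

lemma cell_coarse {D M m : ℕ} (hM : 0 < M) (hm : 0 < m) (j : Fin D → Fin (M * m)) :
    cell D (M * m) j ⊆ cell D M (coarse M m j) := by
  intro x hx i
  have hM' : (0:ℝ) < M := by exact_mod_cast hM
  have hm' : (0:ℝ) < m := by exact_mod_cast hm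
  have h1 := (hx i).1
  have h2 := (hx i).2
  push_cast at h1 h2
  rw [div_le_iff₀ (by positivity)] at h1
  rw [lt_div_iff₀ (by positivity)] at h2
  have h3 : (j i : ℕ) / m * m ≤ (j i : ℕ) := Nat.div_mul_le_self _ _
  have h4 : (j i : ℕ) + 1 ≤ ((j i : ℕ) / m + 1) * m := by
    have := Nat.lt_mul_div_succ (j i : ℕ) hm
    exact lt_of_lt_of_eq this (mul_comm m _)
  have h3' : (((j i : ℕ) / m : ℕ) : ℝ) * m ≤ ((j i : ℕ) : ℝ) := by exact_mod_cast h3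
  have h4' : ((j i : ℕ) : ℝ) + 1 ≤ ((((j i : ℕ) / m : ℕ) : ℝ) + 1) * m := by exact_mod_cast h4
  simp only [coarse]
  constructor
  · rw [div_le_iff₀ hM']
    by_contra hc
    push Not at hc
    nlinarith
  · rw [lt_div_iff₀ hM']
    by_contra hc
    push Not at hc
    nlinarith

lemma nearI_of_abs {R : ℕ} {ρ : ℝ} (hρ : ρ ≤ R) {c j : Fin D → Fin L}
    (h : ∀ i, |((j i : ℕ) : ℝ) - ((c i : ℕ) : ℝ)| ≤ ρ) : nearI R c j := by
  intro i
  have h1 := abs_le.1 (h i)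
  constructor
  · have : ((j i : ℕ) : ℝ) - ((c i : ℕ) : ℝ) ≤ R := by linarith
    exact_mod_cast this
  · have : ((c i : ℕ) : ℝ) - ((j i : ℕ) : ℝ) ≤ R := by linarith
    exact_mod_cast this

lemma near_dist (hL : 0 < L) {R : ℕ} {c j : Fin D → Fin L} (h : nearI R c j)
    {x y : Fin D → ℝ} (hx : x ∈ cell D L c) (hy : y ∈ cell D L j) :
    ‖x - y‖ ≤ (R + 1) / L := by
  have hL' : (0:ℝ) < L := by exact_mod_cast hL
  rw [pi_norm_le_iff_of_nonneg (by positivity)]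
  intro i
  have h1 := (hx i).1
  have h2 := (hx i).2
  have h3 := (hy i).1
  have h4 := (hy i).2
  have h5 : ((j i : ℕ) : ℝ) - ((c i : ℕ) : ℝ) ≤ R := by exact_mod_cast (h i).1
  have h6 : ((c i : ℕ) : ℝ) - ((j i : ℕ) : ℝ) ≤ R := by exact_mod_cast (h i).2
  rw [div_le_iff₀ hL'] at h1 h3
  rw [lt_div_iff₀ hL'] at h2 h4
  rw [Pi.sub_apply, Real.norm_eq_abs, le_div_iff₀ hL', ← abs_of_pos hL', ← abs_mul,
    abs_le]
  constructor <;> nlinarith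

lemma swap_sum {K : ℕ} {G : (Fin D → Fin L) → ℝ} (hG : ∀ j, 0 ≤ G j) (R N0 : ℕ)
    (c : (Fin D → Fin K) → (Fin D → Fin L))
    (hc : ∀ j, ∀ s : Finset (Fin D → Fin K), (∀ k ∈ s, nearI R (c k) j) → s.card ≤ N0) :
    ∑ k, nearS G R (c k) ≤ N0 * ∑ j, G j := by
  classical
  have h1 : ∀ k, nearS G R (c k) = ∑ j, if nearI R (c k) j then G j else 0 := by
    intro k
    rw [nearS, Finset.sum_filter]
  simp only [h1]
  rw [Finset.sum_comm, Finset.mul_sum]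
  refine Finset.sum_le_sum fun j _ => ?_
  rw [← Finset.sum_filter, Finset.sum_const, nsmul_eq_mul]
  have := hc j (Finset.univ.filter fun k => nearI R (c k) j) (by simp)
  have h2 := hG j
  gcongr

lemma quad_bound {T : ℝ} (hT : 0 < T) (F : FlowData D T) {Λ : ℝ} (hΛ : 1 ≤ Λ)
    (hlip : ∀ τ ∈ Set.Icc (0:ℝ) T, ∀ t ∈ Set.Icc (0:ℝ) T,
      ∀ x ∈ Set.Icc (0 : Fin D → ℝ) 1, ∀ y ∈ Set.Icc (0 : Fin D → ℝ) 1,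
      ‖F.X τ t x - F.X τ t y‖ ≤ Λ * ‖x - y‖)
    {R R2 : ℕ} (hR : Λ + 1 ≤ R) (hR2 : 2 * Λ * (2 * R + 1) + 1 ≤ R2)
    {K : ℕ} (hL : 0 < L) (hLK : L ≤ K) (hKL : K ≤ 2 * L)
    {x0 : (Fin D → Fin K) → (Fin D → ℝ)} (hx0 : ∀ k, x0 k ∈ cell D K k)
    {t : ℝ} (ht : t ∈ Set.Icc (0:ℝ) T)
    {G : (Fin D → Fin L) → ℝ} (h : PP D L f P G) :
    |(∫ x in unitCube D, f x) - ∑ k, ((1:ℝ) / K) ^ D * f (F.X 0 t (x0 k))| ≤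
      (1 / (K:ℝ)) ^ D * ((2 * D * R + 2) * (1 / L)) * (((2 * R2 + 1) ^ D : ℕ) * ∑ j, G j) := by
  have hK : 0 < K := lt_of_lt_of_le hL hLK
  have hL' : (0:ℝ) < L := by exact_mod_cast hL
  have hK' : (0:ℝ) < K := by exact_mod_cast hK
  have hLK' : (L:ℝ) ≤ K := by exact_mod_cast hLK
  have hKL' : (K:ℝ) ≤ 2 * L := by exact_mod_cast hKL
  have h0T : (0:ℝ) ∈ Set.Icc (0:ℝ) T := ⟨le_rfl, hT.le⟩
  have hfi := pw_integrable hL h.eq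
  obtain ⟨hmp, hae⟩ := F.mp hT.le ht
  have hx0h : ∀ k, x0 k ∈ hcube D := fun k => cell_sub_hcube hK k (hx0 k)
  have hcex : ∀ k, ∃ j, F.X 0 t (x0 k) ∈ cell D L j := fun k =>
    exists_cell hL (F.inv_hcube h0T ht (hx0h k))
  choose c hc using hcex
  -- change of variables
  have hfi' : IntegrableOn (fun x => f (F.X 0 t x)) (hcube D) := by
    have : Integrable f (Measure.map (F.X 0 t) (volume.restrict (hcube D))) := by
      rw [hmp]; exact hfi
    exact this.comp_aemeasurable hae
  have hint : ∫ x in unitCube D, f x = ∫ x in hcube D, f (F.X 0 t x) := by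
    rw [← setIntegral_congr_set (hcube_ae_unitCube D)]
    conv_lhs => rw [← hmp]
    refine integral_map hae ?_
    rw [hmp]
    exact hfi.aestronglyMeasurable
  have hfi'' : ∀ k : Fin D → Fin K, IntegrableOn (fun x => f (F.X 0 t x)) (cell D K k) := fun k =>
    hfi'.mono_set (cell_sub_hcube hK k)
  have hsplit : ∫ x in hcube D, f (F.X 0 t x) =
      ∑ k : Fin D → Fin K, ∫ x in cell D K k, f (F.X 0 t x) := by
    rw [hcube_eq_iUnion hK]
    exact integral_iUnion_fintype (fun j => measurableSet_cell j) (cell_disjoint hK) hfi''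
  rw [hint, hsplit, ← Finset.sum_sub_distrib]
  have hterm : ∀ k : Fin D → Fin K,
      |(∫ x in cell D K k, f (F.X 0 t x)) - ((1:ℝ) / K) ^ D * f (F.X 0 t (x0 k))| ≤
        (1 / (K:ℝ)) ^ D * ((2 * D * R + 2) * (1 / L)) * nearS G R (c k) := by
    intro k
    have h1 : ((1:ℝ) / K) ^ D * f (F.X 0 t (x0 k)) = ∫ x in cell D K k, f (F.X 0 t (x0 k)) := by
      rw [setIntegral_const, vol_cell, smul_eq_mul]
    have hconst : IntegrableOn (fun _ : Fin D → ℝ => f (F.X 0 t (x0 k))) (cell D K k) :=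
      integrableOn_const (vol_cell_ne_top k)
    rw [h1, ← integral_sub (hfi'' k) hconst]
    have h2 : ∀ x ∈ cell D K k, ‖f (F.X 0 t x) - f (F.X 0 t (x0 k))‖ ≤
        (2 * D * R + 2) * nearS G R (c k) * (1 / L) := by
      intro x hx
      have hxh := cell_sub_hcube hK k hx
      obtain ⟨j, hj⟩ := exists_cell hL (F.inv_hcube h0T ht hxh)
      refine h.osc hL R ?_ (hc k) hj
      have hd : ‖F.X 0 t x - F.X 0 t (x0 k)‖ * L ≤ Λ := by
        have h3 := hlip 0 h0T t ht x (hcube_sub D hxh) (x0 k) (hcube_sub D (hx0h k))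
        have h4 := cell_dist hK (cell_sub_ccell k hx) (cell_sub_ccell k (hx0 k))
        calc ‖F.X 0 t x - F.X 0 t (x0 k)‖ * L ≤ (Λ * (1 / K)) * K := by
              refine mul_le_mul (h3.trans ?_) hLK' hL'.le (by positivity)
              gcongr
          _ = Λ := by field_simp
      exact nearI_of_abs hR (fun i => cell_idx hL hj (hc k) hd i)
    have h5 := norm_setIntegral_le_of_norm_le_const (vol_cell_ne_top k).lt_top h2
    rw [vol_cell] at h5
    rw [Real.norm_eq_abs] at h5
    refine h5.trans (le_of_eq ?_)
    ring
  refine (Finset.abs_sum_le_sum_abs _ _).trans ((Finset.sum_le_sum fun k _ => hterm k).trans ?_)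
  rw [← Finset.mul_sum]
  refine mul_le_mul_of_nonneg_left ?_ (by positivity)
  refine swap_sum (h.nonneg hL) R _ c ?_
  intro j s hs
  refine card_near R2 s ?_
  intro k hk l hl
  have hnear : nearI (2 * R) (c k) (c l) := by
    intro i
    have h1 := hs k hk i
    have h2 := hs l hl i
    push_cast
    omega
  have hd := near_dist hL hnear (hc k) (hc l)
  have hk' := F.inv_hcube h0T ht (hx0h k)
  have hl' := F.inv_hcube h0T ht (hx0h l)
  have h3 := hlip t ht 0 h0T _ (hcube_sub D hk') _ (hcube_sub D hl')
  rw [F.flow_inv, F.flow_inv] at h3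
  have h4 : ‖x0 l - x0 k‖ * K ≤ 2 * Λ * (2 * R + 1) := by
    rw [norm_sub_rev]
    calc ‖x0 k - x0 l‖ * K ≤ (Λ * (((2 * R : ℕ) + 1) / L)) * (2 * L) := by
          refine mul_le_mul (h3.trans ?_) hKL' hK'.le (by positivity)
          gcongr
      _ = 2 * Λ * (2 * R + 1) := by push_cast; field_simp
  exact nearI_of_abs hR2 (fun i => cell_idx hK (hx0 l) (hx0 k) h4 i)

end fin

/-- quadrature error for products of splines, Lemma 1 of the paper.
Let `n ≥ 2` and `h = 1/K ≤ σ = 1/M`.  There is a constant `C > 0` depending only on the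
velocity field (through `F`), `n`, `D` and `T` — but not on `h`, `σ`, `t`, the particle
positions, or the splines — such that for every `t ∈ [0,T]`, every admissible particle
placement `x0` (one particle per cell of the `h`-grid, with weights `w_i = h^D`) and all
splines `u_σ, v_σ ∈ V_σ^n(Ω)`:
`|∫_Ω u_σ v_σ dx − Σ_i w_i u_σ(x_i(t)) v_σ(x_i(t))| ≤ C h |u_σ v_σ|_{W^{1,1}(Ω)}`. -/
theorem spline_quadrature_error
    (D : ℕ) (hD : 0 < D) (T : ℝ) (hT : 0 < T) (F : FlowData D T)
    (n : ℕ) (hn : 2 ≤ n) :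
    ∃ C : ℝ, 0 < C ∧
      ∀ M K : ℕ, 0 < M → M ≤ K →
      ∀ x0 : (Fin D → Fin K) → (Fin D → ℝ), (∀ k, x0 k ∈ cell D K k) →
      ∀ t ∈ Set.Icc (0 : ℝ) T,
      ∀ u v : (Fin D → ℝ) → ℝ, IsSpline D M n u → IsSpline D M n v →
        |(∫ x in unitCube D, u x * v x) -
            ∑ k : Fin D → Fin K,
              ((1 : ℝ) / K) ^ D * (u (F.X 0 t (x0 k)) * v (F.X 0 t (x0 k)))| ≤
          C * ((1 : ℝ) / K) * w11Seminorm D (fun x => u x * v x) := by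
  classical
  obtain ⟨Λ, hΛ, hlip⟩ := F.X_lip
  obtain ⟨Cp, hCp, hgrad⟩ := grad_cell D (2 * (n - 1))
  set R : ℕ := ⌈Λ + 1⌉₊ with hRdef
  set R2 : ℕ := ⌈2 * Λ * (2 * R + 1) + 1⌉₊ with hR2def
  have hR : Λ + 1 ≤ R := Nat.le_ceil _
  have hR2 : 2 * Λ * (2 * R + 1) + 1 ≤ R2 := Nat.le_ceil _
  refine ⟨(2 * D * R + 2) * 2 * ((2 * R2 + 1) ^ D : ℕ) * Cp, by positivity, ?_⟩
  intro M K hM hMK x0 hx0 t ht u v hu hv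
  set m := K / M with hm
  have hm0 : 0 < m := Nat.div_pos hMK hM
  have hL : 0 < M * m := Nat.mul_pos hM hm0
  have hLK : M * m ≤ K := Nat.mul_div_le K M
  have hKL : K ≤ 2 * (M * m) := by
    have h1 : K < M * (m + 1) := Nat.lt_mul_div_succ K hM
    have h2 : M * 1 ≤ M * m := Nat.mul_le_mul_left M hm0
    rw [mul_add] at h1
    omega
  generalize hLdef : M * m = L at *
  choose pu hpu hpu' using hu.2
  choose pv hpv hpv' using hv.2
  subst hLdef
  let P : (Fin D → Fin (M * m)) → MvPolynomial (Fin D) ℝ :=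
    fun j => pu (coarse M m j) * pv (coarse M m j)
  let I : (Fin D → Fin (M * m)) → ℝ := fun j => ∫ y in ccell D (M * m) j,
    ‖fderiv ℝ (fun x : Fin D → ℝ => MvPolynomial.eval x (P j)) y‖
  let G : (Fin D → Fin (M * m)) → ℝ := fun j => ((M * m : ℕ) : ℝ) ^ D * (Cp * I j)
  have hL' : (0:ℝ) < ((M * m : ℕ) : ℝ) := by exact_mod_cast hL
  have hK' : (0:ℝ) < K := lt_of_lt_of_le hL' (by exact_mod_cast hLK)
  have hPdeg : ∀ j i, (P j).degreeOf i ≤ 2 * (n - 1) := by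
    intro j i
    refine (MvPolynomial.degreeOf_mul_le i _ _).trans ?_
    have := hpu (coarse M m j) i
    have := hpv (coarse M m j) i
    omega
  have hPP : PP D (M * m) (fun x => u x * v x) P G := by
    refine ⟨hu.1.continuousOn.mul hv.1.continuousOn, ?_, ?_⟩
    · intro j x hx
      have hx' := cell_coarse hM hm0 j hx
      simp only [P, map_mul]
      rw [hpu' _ x hx', hpv' _ x hx']
    · intro j x hx
      have h1 := hgrad (M * m) hL (fun i => ((j i : ℕ) : ℝ) / (M * m : ℕ)) (P j) (hPdeg j) x hx
      have h2 : (1 / ((M * m : ℕ) : ℝ)) ^ D = (((M * m : ℕ) : ℝ) ^ D)⁻¹ := by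
        rw [one_div, inv_pow]
      rw [h2, inv_mul_le_iff₀ (by positivity)] at h1
      exact h1
  have hmain := quad_bound hT F hΛ hlip hR hR2 hL hLK hKL hx0 ht hPP
  have hsemi : w11Seminorm D (fun x => u x * v x) = ∑ j, I j := pw_seminorm hL hPP.eq
  have hI : 0 ≤ ∑ j, I j :=
    Finset.sum_nonneg fun j _ => integral_nonneg fun y => norm_nonneg _
  refine hmain.trans ?_
  rw [hsemi]
  have hGs : ∑ j, G j = ((M * m : ℕ) : ℝ) ^ D * (Cp * ∑ j, I j) := by
    simp only [G, Finset.mul_sum]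
  rw [hGs]
  have e1 : (1 / (K:ℝ)) ^ D * ((M * m : ℕ) : ℝ) ^ D ≤ 1 := by
    rw [← mul_pow]
    refine pow_le_one₀ (by positivity) ?_
    rw [one_div, inv_mul_le_iff₀ hK', mul_one]
    exact_mod_cast hLK
  have e2 : 1 / ((M * m : ℕ) : ℝ) ≤ 2 * (1 / (K:ℝ)) := by
    rw [mul_one_div, div_le_div_iff₀ hL' hK', one_mul]
    exact_mod_cast hKL
  calc (1 / (K:ℝ)) ^ D * ((2 * D * R + 2) * (1 / ((M * m : ℕ) : ℝ))) *
        (((2 * R2 + 1) ^ D : ℕ) * (((M * m : ℕ) : ℝ) ^ D * (Cp * ∑ j, I j)))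
      = ((1 / (K:ℝ)) ^ D * ((M * m : ℕ) : ℝ) ^ D) * (((2 * D * R + 2) *
          (1 / ((M * m : ℕ) : ℝ))) * (((2 * R2 + 1) ^ D : ℕ) * (Cp * ∑ j, I j))) := by ring
    _ ≤ 1 * (((2 * D * R + 2) * (2 * (1 / (K:ℝ)))) *
          (((2 * R2 + 1) ^ D : ℕ) * (Cp * ∑ j, I j))) := by
        gcongr
    _ = _ := by ring

end
end

section
/- (Exactness on splines) Let n ≥ 2 and suppose h = dσ with 0 < d ≤ d₀, where d₀ ∈ (0,1) is small enough that the form (u,v) ↦ Σ_{i=1}^N w_i u(x_i(t)) v(x_i(t)) is positive definite on V_σ^n(Ω). Let u₀ be continuous on Ω̄, t ∈ [0,T], and suppose the exact advected solution u(·,t) = u₀ ∘ X_{t→0} belongs to V_σ^n(Ω). Then with u_i := u₀(x_i(0)), the unique u_{h,σ} ∈ V_σ^n(Ω) satisfying Σ_{i=1}^N w_i u_{h,σ}(x_i(t)) v(x_i(t)) = Σ_{i=1}^N w_i u_i v(x_i(t)) for all v ∈ V_σ^n(Ω) is u_{h,σ} = u(·,t); i.e., the method reproduces exact spline solutions exactly.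 -/
open MeasureTheory
open scoped ENNReal NNReal

noncomputable section

/-- exactness on splines.
Let `n ≥ 2`, `h = dσ` with `0 < d < 1` small enough that the discrete bilinear form
`(u,v) ↦ Σ_i w_i u(x_i(t)) v(x_i(t))` is positive definite on `V_σ^n(Ω)`.  If `u₀` is
continuous on `Ω̄`, `t ∈ [0,T]`, and the exact advected solution
`u(·,t) = u₀ ∘ X_{t→0}` belongs to `V_σ^n(Ω)`, then with `u_i = u₀(x_i(0))` any
`u_{h,σ} ∈ V_σ^n(Ω)` satisfying
`Σ_i w_i u_{h,σ}(x_i(t)) v(x_i(t)) = Σ_i w_i u_i v(x_i(t))` for all `v ∈ V_σ^n(Ω)`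
coincides with `u(·,t)` on `Ω`: the method reproduces exact spline solutions exactly. -/
theorem exactness_on_splines
    (D : ℕ) (hD : 0 < D) (T : ℝ) (hT : 0 < T) (F : FlowData D T)
    (n : ℕ) (hn : 2 ≤ n) (M K : ℕ) (hM : 0 < M) (hMK : M < K)
    (x0 : (Fin D → Fin K) → (Fin D → ℝ)) (hx0 : ∀ k, x0 k ∈ cell D K k)
    (t : ℝ) (ht : t ∈ Set.Icc (0 : ℝ) T)
    (hpos : ∀ v : (Fin D → ℝ) → ℝ, IsSpline D M n v → (∃ x ∈ unitCube D, v x ≠ 0) →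
      0 < ∑ k : Fin D → Fin K, ((1 : ℝ) / K) ^ D * (v (F.X 0 t (x0 k))) ^ 2)
    (u₀ : (Fin D → ℝ) → ℝ) (hu₀ : ContinuousOn u₀ (closure (unitCube D)))
    (hexact : IsSpline D M n (fun x => u₀ (F.X t 0 x)))
    (uhσ : (Fin D → ℝ) → ℝ) (huhσ : IsSpline D M n uhσ)
    (heq : ∀ v : (Fin D → ℝ) → ℝ, IsSpline D M n v →
      ∑ k : Fin D → Fin K, ((1 : ℝ) / K) ^ D * uhσ (F.X 0 t (x0 k)) * v (F.X 0 t (x0 k)) =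
      ∑ k : Fin D → Fin K, ((1 : ℝ) / K) ^ D * u₀ (x0 k) * v (F.X 0 t (x0 k))) :
    ∀ x ∈ unitCube D, uhσ x = u₀ (F.X t 0 x) := by
  have hv : IsSpline D M n (fun x => uhσ x - u₀ (F.X t 0 x)) := by
    refine ⟨huhσ.1.sub hexact.1, fun k => ?_⟩
    obtain ⟨p, hp, hpe⟩ := huhσ.2 k
    obtain ⟨q, hq, hqe⟩ := hexact.2 k
    refine ⟨p - q, fun i => (MvPolynomial.degreeOf_sub_le i p q).trans (max_le (hp i) (hq i)),
      fun x hx => ?_⟩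
    have h1 := hpe x hx
    have h2 := hqe x hx
    simp only at h2
    simp only [map_sub, h1, h2]
  intro x hx
  by_contra hne
  have h := hpos _ hv ⟨x, hx, sub_ne_zero.mpr hne⟩
  have h2 := heq _ hv
  rw [← sub_eq_zero, ← Finset.sum_sub_distrib] at h2
  refine absurd h (not_lt.mpr (le_of_eq ?_))
  refine Eq.trans ?_ h2
  refine Finset.sum_congr rfl fun k _ => ?_
  simp only [F.flow_inv]
  ring

end
end
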